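/- arXiv:2204.01153 — 2 statements merged into one kernel-verified Lean document; each statement's English description precedes it below -/
import Mathlib

section
/- For every ε > 0 there exists p₀ such that for every prime p > p₀ one has |A(p)| ≥ (√2 − ε)·√p. -/
/-- For a prime `p`, `A(p) = {n! mod p : 1 ≤ n ≤ p-1} ⊆ ZMod p`. -/
def factorialResidues (p : ℕ) : Finset (ZMod p) :=
  (Finset.Icc 1 (p - 1)).image (fun n => (n.factorial : ZMod p))

namespace FactorialResidues

open Polynomial
open scoped Polynomial.Bivariate

section Irreducibility

variable {K : Type*} [Field K]

lemma card_filter_eval_eq_zero [DecidableEq K] {u v f : K[X]} {s : Finset K}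
    (hf : f = ∏ r ∈ s, (X - C r)) (huv : u * v = f) :
    (s.filter fun r => u.eval r = 0).card = u.natDegree := by
  have hf0 : f ≠ 0 := by
    rw [hf]; exact (monic_prod_of_monic _ _ fun r _ => monic_X_sub_C r).ne_zero
  have hdvd : u ∣ f := ⟨v, huv.symm⟩
  have hu0 : u ≠ 0 := ne_zero_of_dvd_ne_zero hf0 hdvd
  have hroots : f.roots = s.val := by rw [hf]; exact roots_prod_X_sub_C s
  have hsplit : f.Splits := by
    rw [hf]; exact Splits.prod fun r _ => Splits.X_sub_C r
  have hle : u.roots ≤ s.val := hroots ▸ roots.le_of_dvd hf0 hdvd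
  have hnodup : u.roots.Nodup := Multiset.nodup_of_le hle s.nodup
  rw [(hsplit.of_dvd hf0 hdvd).natDegree_eq_card_roots, ← Multiset.toFinset_card_of_nodup hnodup]
  congr 1
  ext r
  simp only [Finset.mem_filter, Multiset.mem_toFinset, mem_roots hu0, IsRoot.def]
  refine ⟨fun h => h.2, fun h => ⟨?_, h⟩⟩
  exact Multiset.mem_of_le hle ((mem_roots hu0).2 h)

lemma monic_map_C_sub_C {f : K[X]} (hf : f.Monic) (hd : 0 < f.natDegree) (g : K[X]) :
    (f.map C - C g : K[X][Y]).Monic := by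
  refine (hf.map C).sub_of_left (lt_of_le_of_lt degree_C_le ?_)
  rw [degree_eq_natDegree (hf.map C).ne_zero, hf.natDegree_map]
  exact_mod_cast hd

lemma natDegree_map_C_sub_C (f g : K[X]) :
    (f.map C - C g : K[X][Y]).natDegree = f.natDegree := by
  rw [natDegree_sub_C, natDegree_map_eq_of_injective C_injective]

lemma card_filter_evalEval_eq_zero [DecidableEq K] {f g : K[X]} {s : Finset K} (hs : s.Nonempty)
    (hf : f = ∏ r ∈ s, (X - C r)) {A B : K[X][Y]} (hAB : A * B = f.map C - C g)
    {x : K} (hx : g.eval x = 0) :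
    (s.filter fun r => A.evalEval x r = 0).card = A.natDegree := by
  have hfm : f.Monic := by
    rw [hf]; exact monic_prod_of_monic _ _ fun r _ => monic_X_sub_C r
  have hfd : f.natDegree = s.card := by
    rw [hf]
    exact natDegree_finsetProd_X_sub_C_eq_card s fun r => r
  have hne : A * B ≠ 0 := by
    rw [hAB]; exact (monic_map_C_sub_C hfm (hfd ▸ hs.card_pos) g).ne_zero
  have hdeg : A.natDegree + B.natDegree = f.natDegree := by
    rw [← natDegree_mul (left_ne_zero_of_mul hne) (right_ne_zero_of_mul hne), hAB,
      natDegree_map_C_sub_C]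
  have hmul : A.map (evalRingHom x) * B.map (evalRingHom x) = f := by
    rw [← Polynomial.map_mul, hAB]
    simp only [Polynomial.map_sub, Polynomial.map_map, map_C, coe_evalRingHom, hx, C_0, sub_zero]
    have : (evalRingHom x).comp (C : K →+* K[X]) = RingHom.id K := by ext; simp
    rw [this, Polynomial.map_id]
  have hne' : A.map (evalRingHom x) * B.map (evalRingHom x) ≠ 0 := hmul ▸ hfm.ne_zero
  have hdeg' := natDegree_mul (left_ne_zero_of_mul hne') (right_ne_zero_of_mul hne')
  rw [hmul] at hdeg'
  have hA := natDegree_map_le (f := evalRingHom x) (p := A)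
  have hB := natDegree_map_le (f := evalRingHom x) (p := B)
  have := card_filter_eval_eq_zero hf hmul
  simp only [map_evalRingHom_eval] at this
  omega

lemma swap_map_C_sub_C (f g : K[X]) :
    Bivariate.swap (f.map C - C g : K[X][Y]) = -(g.map C - C f) := by
  rw [map_sub, Bivariate.swap_map_C, Bivariate.swap_C]; ring

lemma evalEval_swap (A : K[X][Y]) (x y : K) :
    (Bivariate.swap A).evalEval x y = A.evalEval y x := by
  have := Bivariate.aevalAeval_swap x y A
  rw [coe_aevalAeval_eq_evalEval, coe_aevalAeval_eq_evalEval] at this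
  exact this

lemma card_mul_natDegree_eq {f g : K[X]} {s t : Finset K} (hs : s.Nonempty) (ht : t.Nonempty)
    (hf : f = ∏ r ∈ s, (X - C r)) (hg : g = ∏ r ∈ t, (X - C r))
    {A B : K[X][Y]} (hAB : A * B = f.map C - C g) :
    t.card * A.natDegree = s.card * (Bivariate.swap A).natDegree := by
  classical
  have hAB' : Bivariate.swap A * -Bivariate.swap B = g.map C - C f := by
    have h : Bivariate.swap A * Bivariate.swap B = -(g.map C - C f) := by
      rw [← map_mul, hAB, swap_map_C_sub_C]
    linear_combination -h
  have h := Finset.sum_card_bipartiteAbove_eq_sum_card_bipartiteBelow (s := t) (t := s)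
    (fun x y => A.evalEval x y = 0)
  unfold Finset.bipartiteAbove Finset.bipartiteBelow at h
  have h₁ : ∀ x ∈ t, (s.filter fun y => A.evalEval x y = 0).card = A.natDegree := by
    refine fun x hx => card_filter_evalEval_eq_zero hs hf hAB ?_
    rw [hg, eval_prod]
    exact Finset.prod_eq_zero hx (by simp)
  have h₂ : ∀ y ∈ s, (t.filter fun x => A.evalEval x y = 0).card =
      (Bivariate.swap A).natDegree := by
    intro y hy
    simp_rw [← evalEval_swap A]
    refine card_filter_evalEval_eq_zero ht hg hAB' ?_
    rw [hf, eval_prod]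
    exact Finset.prod_eq_zero hy (by simp)
  rwa [Finset.sum_congr rfl h₁, Finset.sum_congr rfl h₂, Finset.sum_const, Finset.sum_const,
    smul_eq_mul, smul_eq_mul] at h

/-- The substitution `X ↦ -X` on bivariate polynomials. -/
noncomputable def reflectX : K[X][Y] →+* K[X][Y] := mapRingHom (compRingHom (-X))

lemma swap_reflectX (A : K[X][Y]) :
    Bivariate.swap (reflectX A) = (Bivariate.swap A).comp (-X) := by
  have : ((Bivariate.swap (R := K) : K[X][Y] →+* K[X][Y]).comp reflectX) =
      (compRingHom (-X)).comp (Bivariate.swap (R := K) : K[X][Y] →+* K[X][Y]) := by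
    unfold reflectX
    refine Polynomial.ringHom_ext' (Polynomial.ringHom_ext' ?_ ?_) ?_
    · ext1 c
      simp [Bivariate.swap_C_C]
    · simp [Bivariate.swap_X]
    · simp [Bivariate.swap_Y]
  exact RingHom.congr_fun this A

theorem irreducible_map_C_sub_C (h2 : (2 : K) ≠ 0) {f g : K[X]} {s t : Finset K} {i j : ℕ}
    (hi : Odd i) (hj : Odd j) (hij : i.Coprime j)
    (hs : s.card = 2 * i) (ht : t.card = 2 * j)
    (hf : f = ∏ r ∈ s, (X - C r)) (hg : g = ∏ r ∈ t, (X - C r))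
    (hfe : f.comp (-X) = f) (hge : g.comp (-X) = g) (h0 : f.eval 0 ≠ g.eval 0) :
    Irreducible (f.map C - C g : K[X][Y]) := by
  have hipos := hi.pos
  have hjpos := hj.pos
  have hsne : s.Nonempty := Finset.card_pos.1 (by omega)
  have htne : t.Nonempty := Finset.card_pos.1 (by omega)
  have hfm : f.Monic := by
    rw [hf]; exact monic_prod_of_monic _ _ fun r _ => monic_X_sub_C r
  have hfd : f.natDegree = 2 * i := by
    rw [← hs, hf]; exact natDegree_finsetProd_X_sub_C_eq_card s fun r => r
  have hFm : (f.map C - C g : K[X][Y]).Monic := monic_map_C_sub_C hfm (by omega) g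
  have hFd : (f.map C - C g : K[X][Y]).natDegree = 2 * i := by rw [natDegree_map_C_sub_C, hfd]
  have hdvd : ∀ A B : K[X][Y], A * B = f.map C - C g →
      j * A.natDegree = i * (Bivariate.swap A).natDegree ∧ i ∣ A.natDegree := by
    intro A B hAB
    have h := card_mul_natDegree_eq hsne htne hf hg hAB
    rw [hs, ht, mul_assoc, mul_assoc] at h
    have h' := Nat.eq_of_mul_eq_mul_left two_pos h
    exact ⟨h', hij.dvd_of_dvd_mul_left ⟨_, h'⟩⟩
  rw [hFm.irreducible_iff_natDegree]
  refine ⟨fun h => by rw [h, natDegree_one] at hFd; omega, fun A B hA hB hAB => ?_⟩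
  by_contra! hcon
  obtain ⟨hA0, hB0⟩ := hcon
  have hsum : A.natDegree + B.natDegree = 2 * i := by
    rw [← hFd, ← hAB, hA.natDegree_mul hB]
  have hiA : A.natDegree = i := by
    obtain ⟨a, ha⟩ := (hdvd A B hAB).2
    obtain ⟨b, hb⟩ := (hdvd B A (by rw [mul_comm, hAB])).2
    have ha1 : a ≠ 0 := by rintro rfl; simp at ha; omega
    have hb1 : b ≠ 0 := by rintro rfl; simp at hb; omega
    have : i * (a + b) = i * 2 := by rw [mul_add, ← ha, ← hb, hsum, mul_comm]
    have := Nat.eq_of_mul_eq_mul_left hipos this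
    have : a = 1 := by omega
    rw [ha, this, mul_one]
  have hiB : B.natDegree = i := by omega
  have hirr : Irreducible A := by
    rw [hA.irreducible_iff_natDegree]
    refine ⟨fun h => by rw [h, natDegree_one] at hiA; omega, fun A₁ A₂ h₁ h₂ h₁₂ => ?_⟩
    have hd := h₁.natDegree_mul h₂
    rw [h₁₂, hiA] at hd
    obtain ⟨a, ha⟩ := (hdvd A₁ (A₂ * B) (by rw [← mul_assoc, h₁₂, hAB])).2
    rcases Nat.eq_zero_or_pos a with rfl | h
    · left; simpa using ha
    · right
      have := Nat.le_mul_of_pos_right i h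
      omega
  have hrefl : reflectX (f.map C - C g : K[X][Y]) = f.map C - C g := by
    unfold reflectX
    simp only [map_sub, coe_mapRingHom, Polynomial.map_map, map_C, coe_compRingHom]
    rw [hge]
    congr 2
    ext; simp
  have hAr : (reflectX A).Monic := hA.map _
  have hBr : (reflectX B).Monic := hB.map _
  have hABr : reflectX A * reflectX B = f.map C - C g := by rw [← map_mul, hAB, hrefl]
  have hdAr : (reflectX A).natDegree = i := by rw [← hiA]; exact hA.natDegree_map _
  have hdBr : (reflectX B).natDegree = i := by rw [← hiB]; exact hB.natDegree_map _
  have hAdvd : A ∣ reflectX A * reflectX B := ⟨B, by rw [hABr, hAB]⟩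
  rcases hirr.prime.dvd_or_dvd hAdvd with h | h
  · have heq : A = reflectX A :=
      eq_of_monic_of_associated hA hAr
        (associated_of_dvd_of_natDegree_le_of_leadingCoeff h
          (by rw [hdAr, hiA]) (by rw [hA.leadingCoeff, hAr.leadingCoeff]))
    have hsw := swap_reflectX A
    rw [← heq] at hsw
    have hlc := congrArg leadingCoeff hsw
    have he : (Bivariate.swap A).natDegree = j := by
      have := (hdvd A B hAB).1
      rw [hiA, mul_comm] at this
      exact (Nat.eq_of_mul_eq_mul_left hipos this).symm
    rw [comp_neg_X_leadingCoeff_eq, he, hj.neg_one_pow, neg_one_mul, eq_neg_iff_add_eq_zero,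
      ← two_mul] at hlc
    rcases mul_eq_zero.1 hlc with h | h
    · apply h2
      have := congrArg (eval 0) h
      simpa using this
    · rw [leadingCoeff_eq_zero] at h
      rw [h, natDegree_zero] at he
      omega
  · have heq : A = reflectX B :=
      eq_of_monic_of_associated hA hBr
        (associated_of_dvd_of_natDegree_le_of_leadingCoeff h
          (by rw [hdBr, hiA]) (by rw [hA.leadingCoeff, hBr.leadingCoeff]))
    set u := B.map (evalRingHom 0) with hu
    have hAu : A.map (evalRingHom 0) = u := by
      rw [heq, hu]
      unfold reflectX
      rw [coe_mapRingHom, Polynomial.map_map]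
      congr 1
      ext <;> simp
    have hsq : u * u = f - C (g.eval 0) := by
      have := congrArg (Polynomial.map (evalRingHom (0 : K))) hAB
      rw [Polynomial.map_mul, hAu, ← hu] at this
      rw [this]
      simp only [Polynomial.map_sub, Polynomial.map_map, map_C, coe_evalRingHom]
      have : (evalRingHom (0 : K)).comp (C : K →+* K[X]) = RingHom.id K := by ext; simp
      rw [this, Polynomial.map_id]
    have hum : u.Monic := hB.map _
    have hud : u.natDegree = i := by rw [← hiB]; exact hB.natDegree_map _
    have hsq' : u.comp (-X) * u.comp (-X) = u * u := by
      rw [← mul_comp, hsq, sub_comp, hfe, C_comp]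
    have hu0 : u.eval 0 = 0 := by
      have hlc := comp_neg_X_leadingCoeff_eq u
      rw [hud, hi.neg_one_pow, hum.leadingCoeff] at hlc
      rcases mul_self_eq_mul_self_iff.1 hsq' with h | h
      · rw [h, hum.leadingCoeff, mul_one] at hlc
        exact absurd (by linear_combination hlc) h2
      · have := congrArg (eval 0) h
        simp only [eval_comp, eval_neg, eval_X, neg_zero] at this
        have h3 : 2 * u.eval 0 = 0 := by linear_combination this
        exact (mul_eq_zero.1 h3).resolve_left h2
    apply h0
    have := congrArg (eval 0) hsq
    rw [eval_mul, hu0, eval_sub, eval_C] at this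
    linear_combination -this

end Irreducibility

section Stepanov

/-- The derivatives of `f` of order less than `M` all vanish at the point `P`. -/
def VanishesToOrder {K R : Type*} [Field K] [CommRing R] [Algebra K R] (δ : Derivation K R R)
    (P : R →ₐ[K] K) (M : ℕ) (f : R) : Prop :=
  ∀ m < M, P (δ^[m] f) = 0

/-- `U` behaves like the filtration of the coordinate ring of an affine curve by pole order:
`U d` has dimension `D * (d + 1)`, and products and derivatives shift the filtration by at
most `c`. -/
structure IsCurveFiltration {K R : Type*} [Field K] [CommRing R] [Algebra K R]
    (δ : Derivation K R R) (D c : ℕ) (U : ℕ → Submodule K R) : Prop where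
  mono : Monotone U
  exists_mem : ∀ f, ∃ d, f ∈ U d
  finite : ∀ d, Module.Finite K (U d)
  finrank_eq : ∀ d, Module.finrank K (U d) = D * (d + 1)
  mul_mem : ∀ {d e : ℕ} {f g : R}, f ∈ U d → g ∈ U e → f * g ∈ U (d + e + c)
  deriv_mem : ∀ {d : ℕ} {f : R}, f ∈ U d → δ f ∈ U (d + c)

variable {K R : Type*} [Field K] [CommRing R] [Algebra K R] {δ : Derivation K R R}

namespace VanishesToOrder

variable {P : R →ₐ[K] K} {M : ℕ} {f g : R}

lemma succ_iff : VanishesToOrder δ P (M + 1) f ↔ P f = 0 ∧ VanishesToOrder δ P M (δ f) := by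
  constructor
  · intro h
    exact ⟨h 0 M.succ_pos, fun m hm => by simpa using h (m + 1) (by omega)⟩
  · rintro ⟨h0, h⟩ m hm
    cases m with
    | zero => simpa using h0
    | succ m => simpa using h m (by omega)

lemma mono {N : ℕ} (h : VanishesToOrder δ P M f) (hN : N ≤ M) : VanishesToOrder δ P N f :=
  fun m hm => h m (hm.trans_le hN)

lemma add (hf : VanishesToOrder δ P M f) (hg : VanishesToOrder δ P M g) :
    VanishesToOrder δ P M (f + g) := fun m hm => by
  rw [iterate_map_add, map_add, hf m hm, hg m hm, add_zero]

lemma mul_right (h : VanishesToOrder δ P M f) (g : R) : VanishesToOrder δ P M (f * g) := by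
  induction M generalizing f g with
  | zero => intro m hm; omega
  | succ M ih =>
    have h' := succ_iff.1 h
    refine succ_iff.2 ⟨by rw [map_mul, h'.1, zero_mul], ?_⟩
    rw [Derivation.leibniz, smul_eq_mul, smul_eq_mul, mul_comm g]
    exact (ih (h.mono M.le_succ) _).add (ih h'.2 _)

end VanishesToOrder

lemma derivation_pow_succ_mul (u f : R) (M : ℕ) :
    δ (u ^ (M + 1) * f) = u ^ M * ((M + 1 : ℕ) * (δ u * f) + u * δ f) := by
  rw [Derivation.leibniz, Derivation.leibniz_pow]
  simp only [smul_eq_mul, nsmul_eq_mul, Nat.add_sub_cancel]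
  ring

lemma vanishesToOrder_pow_mul {P : R →ₐ[K] K} {u : R} (hu : P u = 0) (M : ℕ) (f : R) :
    VanishesToOrder δ P M (u ^ M * f) := by
  induction M generalizing f with
  | zero => intro m hm; omega
  | succ M ih =>
    refine VanishesToOrder.succ_iff.2 ⟨by simp [hu], ?_⟩
    rw [derivation_pow_succ_mul]
    exact ih _

lemma map_iterate_pow_mul {P : R →ₐ[K] K} {u : R} (hu : P u = 0) (m : ℕ) (f : R) :
    P (δ^[m] (u ^ m * f)) = m.factorial * P (δ u) ^ m * P f := by
  induction m generalizing f with
  | zero => simp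
  | succ m ih =>
    rw [Function.iterate_succ_apply, derivation_pow_succ_mul, ih]
    simp only [map_add, map_mul, hu, map_natCast, Nat.factorial_succ]
    push_cast
    ring

/-- The linear map recording the derivatives of order less than `M` at the points of `T`. -/
noncomputable def jet (δ : Derivation K R R) (T : Finset (R →ₐ[K] K)) (M : ℕ) :
    R →ₗ[K] (T × Fin M → K) :=
  LinearMap.pi fun i => i.1.1.toLinearMap ∘ₗ ((δ : R →ₗ[K] R) ^ (i.2 : ℕ))

lemma jet_apply (T : Finset (R →ₐ[K] K)) (M : ℕ) (f : R) (i : T × Fin M) :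
    jet δ T M f i = i.1.1 (δ^[i.2] f) := by
  simp [jet, Module.End.pow_apply]

lemma jet_surjective {T : Finset (R →ₐ[K] K)} {M : ℕ}
    (hM : ∀ m < M, (m.factorial : K) ≠ 0) (hT : ∀ P ∈ T, ∃ u, P u = 0 ∧ P (δ u) ≠ 0) :
    Function.Surjective (jet δ T M) := by
  classical
  have key : ∀ (P : T) (n : ℕ) (m : Fin M), M ≤ m + n →
      Pi.single (P, m) 1 ∈ LinearMap.range (jet δ T M) := by
    intro P n
    induction n with
    | zero => intro m hm; have := m.2; omega
    | succ n ih =>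
      intro m hm
      obtain ⟨u, hu0, hu1⟩ := hT P.1 P.2
      have hsep : ∀ Q : R →ₐ[K] K, ∃ r : R, Q r = 0 ∧ (Q ≠ P.1 → P.1 r ≠ 0) := by
        intro Q
        by_cases hQ : Q = P.1
        · exact ⟨0, map_zero _, fun h => absurd hQ h⟩
        · obtain ⟨r, hr⟩ : ∃ r, Q r ≠ P.1 r := by
            by_contra! h
            exact hQ (AlgHom.ext h)
          refine ⟨r - algebraMap K R (Q r), by simp, fun _ => ?_⟩
          rw [map_sub, AlgHom.commutes, Algebra.algebraMap_self_apply, sub_ne_zero]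
          exact hr.symm
      choose l hl0 hl1 using hsep
      set L : R := ∏ Q ∈ T.erase P.1, l Q ^ M with hL
      have hPL : P.1 L ≠ 0 := by
        rw [hL, map_prod]
        refine Finset.prod_ne_zero_iff.2 fun Q hQ => ?_
        rw [map_pow]
        exact pow_ne_zero _ (hl1 Q (Finset.ne_of_mem_erase hQ))
      set v := jet δ T M (u ^ (m : ℕ) * L) with hv
      have hvm : v (P, m) ≠ 0 := by
        rw [hv, jet_apply, map_iterate_pow_mul hu0]
        exact mul_ne_zero (mul_ne_zero (hM m m.2) (pow_ne_zero _ hu1)) hPL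
      have hrest : ∀ i ∈ Finset.univ.erase (P, m),
          v i • (Pi.single i 1 : T × Fin M → K) ∈ LinearMap.range (jet δ T M) := by
        rintro ⟨Q, k⟩ hi
        by_cases hQ : Q = P
        · subst hQ
          rcases lt_trichotomy (k : ℕ) m with h | h | h
          · have : v (Q, k) = 0 := by
              rw [hv, jet_apply]
              exact vanishesToOrder_pow_mul hu0 m L k h
            rw [this, zero_smul]
            exact Submodule.zero_mem _
          · exact absurd (by rw [Fin.ext h]) (Finset.ne_of_mem_erase hi)
          · exact Submodule.smul_mem _ _ (ih k (by omega))
        · have : v (Q, k) = 0 := by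
            have hQT : Q.1 ∈ T.erase P.1 :=
              Finset.mem_erase.2 ⟨fun h => hQ (Subtype.ext h), Q.2⟩
            rw [hv, jet_apply, hL, ← Finset.mul_prod_erase _ _ hQT, mul_left_comm]
            exact vanishesToOrder_pow_mul (hl0 Q.1) M _ k k.2
          rw [this, zero_smul]
          exact Submodule.zero_mem _
      have hsum : v = ∑ i, v i • (Pi.single i 1 : T × Fin M → K) := by
        ext i
        simp [Finset.sum_apply, Pi.single_apply]
      have hmem : v (P, m) • (Pi.single (P, m) 1 : T × Fin M → K) ∈
          LinearMap.range (jet δ T M) := by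
        rw [← Finset.add_sum_erase _ _ (Finset.mem_univ (P, m))] at hsum
        rw [eq_sub_of_add_eq hsum.symm]
        exact Submodule.sub_mem _ ⟨_, rfl⟩ (Submodule.sum_mem _ hrest)
      have := Submodule.smul_mem _ (v (P, m))⁻¹ hmem
      rwa [smul_smul, inv_mul_cancel₀ hvm, one_smul] at this
  rw [← LinearMap.range_eq_top, eq_top_iff]
  intro w _
  have hw : w = ∑ i, w i • (Pi.single i 1 : T × Fin M → K) := by
    ext i
    simp [Finset.sum_apply, Pi.single_apply]
  rw [hw]
  exact Submodule.sum_mem _ fun i _ => Submodule.smul_mem _ _ (key i.1 M i.2 (by omega))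

namespace IsCurveFiltration

variable {D c : ℕ} {U : ℕ → Submodule K R}

lemma pow_mem (hU : IsCurveFiltration δ D c U) {d : ℕ} {f : R} (hf : f ∈ U d) {n : ℕ}
    (hn : 0 < n) : f ^ n ∈ U (n * d + n * c) := by
  induction n, hn using Nat.le_induction with
  | base => rw [pow_one]; exact hU.mono (by omega) hf
  | succ n _ ih =>
    rw [pow_succ]
    exact hU.mono (by ring_nf; omega) (hU.mul_mem ih hf)

lemma iterate_deriv_mem (hU : IsCurveFiltration δ D c U) {d : ℕ} {f : R} (hf : f ∈ U d)
    (m : ℕ) : δ^[m] f ∈ U (d + m * c) := by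
  induction m with
  | zero => simpa using hf
  | succ m ih =>
    rw [Function.iterate_succ_apply']
    exact hU.mono (by ring_nf; omega) (hU.deriv_mem ih)

/-- A nonzero function in `U e` has at most `D * (e + c)` zeros, counted with multiplicity. -/
theorem mul_card_le [IsDomain R] (hU : IsCurveFiltration δ D c U) {T : Finset (R →ₐ[K] K)}
    {M : ℕ} (hM : ∀ m < M, (m.factorial : K) ≠ 0)
    (hT : ∀ P ∈ T, ∃ u, P u = 0 ∧ P (δ u) ≠ 0) {e : ℕ} {G : R} (hG : G ∈ U e) (hG0 : G ≠ 0)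
    (hv : ∀ P ∈ T, VanishesToOrder δ P M G) : M * T.card ≤ D * (e + c) := by
  classical
  have hsurj := jet_surjective (δ := δ) hM hT
  choose pre hpre using hsurj
  choose lev hlev using hU.exists_mem
  set d := Finset.univ.sup fun i : T × Fin M => lev (pre (Pi.single i 1)) with hd
  have := hU.finite (d + e + c)
  have := hU.finite d
  set ψ := (jet δ T M).domRestrict (U (d + e + c)) with hψ
  have hrange : LinearMap.range ψ = ⊤ := by
    rw [eq_top_iff]
    intro w _
    have hw : w = ∑ i, w i • (Pi.single i 1 : T × Fin M → K) := by
      ext i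
      simp [Finset.sum_apply, Pi.single_apply]
    rw [hw]
    refine Submodule.sum_mem _ fun i _ => Submodule.smul_mem _ _ ?_
    have hi : lev (pre (Pi.single i 1)) ≤ d :=
      Finset.le_sup (f := fun i : T × Fin M => lev (pre (Pi.single i 1))) (Finset.mem_univ i)
    exact ⟨⟨pre (Pi.single i 1), hU.mono (by omega) (hlev _)⟩, hpre _⟩
  have hker : Module.finrank K (U d) ≤ Module.finrank K (LinearMap.ker ψ) := by
    let φ : U d →ₗ[K] LinearMap.ker ψ :=
      LinearMap.codRestrict _ (LinearMap.codRestrict _ ((LinearMap.mulLeft K G).domRestrict (U d))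
        fun f => hU.mono (by omega) (hU.mul_mem hG f.2)) fun f => by
          rw [LinearMap.mem_ker]
          ext i
          exact (jet_apply T M (G * f.1) i).trans ((hv i.1.1 i.1.2).mul_right f.1 i.2 i.2.2)
    refine LinearMap.finrank_le_finrank_of_injective (f := φ) fun f g hfg => ?_
    have : G * f.1 = G * g.1 := congrArg (fun z => (z.1.1 : R)) hfg
    exact Subtype.ext (mul_left_cancel₀ hG0 this)
  have hrn := LinearMap.finrank_range_add_finrank_ker ψ
  rw [hrange, finrank_top, Module.finrank_fintype_fun_eq_card, Fintype.card_prod, Fintype.card_fin,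
    Fintype.card_coe, hU.finrank_eq] at hrn
  rw [hU.finrank_eq] at hker
  have h1 : D * (d + e + c + 1) = D * (d + 1) + D * (e + c) := by ring
  have h2 := mul_comm M T.card
  omega

/-- Dimension count behind the auxiliary function in Stepanov's method. -/
lemma exists_coeff_ne_zero (hU : IsCurveFiltration δ D c U) (hD : 0 < D) {a B : ℕ} {ι : Type*}
    [Fintype ι] (e : ι → R) (he : ∀ μ, e μ ∈ U a) (hι : Fintype.card ι = D * (a + 1))
    (ha : B * (D * B * c + B + c) < a + 1) :
    ∃ h : ι → R, (∀ μ, h μ ∈ U B) ∧ (∃ μ, h μ ≠ 0) ∧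
      ∀ m < D * B, ∑ μ, δ^[m] (e μ) * h μ = 0 := by
  have := hU.finite B
  have := hU.finite (a + D * B * c + B + c)
  let Ψ : (ι → U B) →ₗ[K] (Fin (D * B) → U (a + D * B * c + B + c)) :=
    LinearMap.pi fun m => LinearMap.codRestrict _
      (∑ μ, LinearMap.mulLeft K (δ^[m] (e μ)) ∘ₗ (U B).subtype ∘ₗ LinearMap.proj μ) fun h => by
        rw [LinearMap.sum_apply]
        refine Submodule.sum_mem _ fun μ _ => ?_
        refine hU.mono ?_ (hU.mul_mem (hU.iterate_deriv_mem (he μ) m) (h μ).2)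
        have := Nat.mul_le_mul_right c m.2.le
        omega
  have hlt : Module.finrank K (Fin (D * B) → U (a + D * B * c + B + c)) <
      Module.finrank K (ι → U B) := by
    rw [Module.finrank_pi_fintype, Module.finrank_pi_fintype]
    simp only [hU.finrank_eq, Finset.sum_const, Finset.card_univ, Fintype.card_fin, hι, smul_eq_mul]
    have h1 : D * B * (D * (a + D * B * c + B + c + 1)) =
        D * D * (B * (a + 1) + B * (D * B * c + B + c)) := by ring
    have h2 : D * (a + 1) * (D * (B + 1)) = D * D * (B * (a + 1) + (a + 1)) := by ring
    rw [h1, h2]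
    exact Nat.mul_lt_mul_of_pos_left (by omega) (by positivity)
  obtain ⟨h, hh, hne⟩ := (Submodule.ne_bot_iff _).1
    (LinearMap.ker_ne_bot_of_finrank_lt hlt (f := Ψ))
  refine ⟨fun μ => h μ, fun μ => (h μ).2, ?_, fun m hm => ?_⟩
  · by_contra! h0
    exact hne (funext fun μ => Subtype.ext (h0 μ))
  · have h1 := congrArg (Subtype.val (p := (· ∈ U (a + D * B * c + B + c))))
      (congrFun (LinearMap.mem_ker.1 hh) ⟨m, hm⟩)
    simpa [Ψ, LinearMap.sum_apply] using h1

end IsCurveFiltration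

lemma iterate_derivation_sum {ι : Type*} (s : Finset ι) (f : ι → R) (m : ℕ) :
    δ^[m] (∑ μ ∈ s, f μ) = ∑ μ ∈ s, δ^[m] (f μ) := by
  rw [← Derivation.coeFn_coe, ← Module.End.coe_pow, map_sum]

section ZMod

variable {p : ℕ} [Fact p.Prime] {R : Type*} [CommRing R] [IsDomain R] [Algebra (ZMod p) R]
  {δ : Derivation (ZMod p) R R}

lemma iterate_derivation_mul_pow (f h : R) (m : ℕ) : δ^[m] (f * h ^ p) = δ^[m] f * h ^ p := by
  have := charP_of_injective_algebraMap (algebraMap (ZMod p) R).injective p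
  induction m with
  | zero => rfl
  | succ m ih =>
    rw [Function.iterate_succ_apply', ih, Derivation.leibniz, Derivation.leibniz_pow,
      ← Function.iterate_succ_apply' δ]
    simp [mul_comm]

lemma factorial_ne_zero_of_lt {m : ℕ} (hm : m < p) : (m.factorial : ZMod p) ≠ 0 := by
  rw [Ne, ZMod.natCast_eq_zero_iff, (Fact.out : p.Prime).dvd_factorial]
  omega

/-- The main inequality of Stepanov's method. -/
theorem IsCurveFiltration.mul_card_le_of_separated {D c : ℕ} {U : ℕ → Submodule (ZMod p) R}
    (hU : IsCurveFiltration δ D c U) (hD : 0 < D) {S : Finset (R →ₐ[ZMod p] ZMod p)}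
    (hS : ∀ P ∈ S, ∃ u, P u = 0 ∧ P (δ u) ≠ 0) {a B : ℕ} (hp : D * (a + c) < p)
    (hB : D * B ≤ p) (ha : B * (D * B * c + B + c) < a + 1) (hSc : D * (B + c) < S.card) :
    B * S.card ≤ a + p * B + p * c + 2 * c := by
  have := hU.finite a
  let b := Module.finBasis (ZMod p) (U a)
  obtain ⟨h, hhU, ⟨μ₀, hμ₀⟩, hh⟩ := hU.exists_coeff_ne_zero hD (fun μ => (b μ : R))
    (fun μ => (b μ).2) (by rw [Fintype.card_fin, hU.finrank_eq]) ha
  set Φ : R := ∑ μ, (b μ : R) * h μ ^ p with hΦ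
  have hPΦ : ∀ (P : R →ₐ[ZMod p] ZMod p) (m : ℕ),
      P (δ^[m] Φ) = ∑ μ, P (δ^[m] (b μ : R)) * P (h μ) := by
    intro P m
    rw [hΦ, iterate_derivation_sum, map_sum]
    refine Finset.sum_congr rfl fun μ _ => ?_
    rw [iterate_derivation_mul_pow, map_mul, map_pow, ZMod.pow_card]
  have hvan : ∀ P ∈ S, VanishesToOrder δ P (D * B) Φ := by
    intro P _ m hm
    rw [hPΦ, ← map_zero P, ← hh m hm, map_sum]
    exact Finset.sum_congr rfl fun μ _ => (map_mul _ _ _).symm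
  have hppos : 0 < p := (Fact.out : p.Prime).pos
  have hΦU : Φ ∈ U (a + (p * B + p * c) + c) :=
    Submodule.sum_mem _ fun μ _ => hU.mul_mem (b μ).2 (hU.pow_mem (hhU μ) hppos)
  have hΦ0 : Φ ≠ 0 := by
    intro h0
    obtain ⟨P, hPS, hP⟩ : ∃ P ∈ S, P (h μ₀) ≠ 0 := by
      by_contra! hcon
      have := hU.mul_card_le (M := 1) (fun m hm => factorial_ne_zero_of_lt (by omega)) hS
        (hhU μ₀) hμ₀ fun P hP m hm => by
          obtain rfl : m = 0 := by omega
          exact hcon P hP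
      omega
    have hf0 : ∑ μ, P (h μ) • b μ ≠ 0 := by
      intro hs
      exact hP (Fintype.linearIndependent_iff.1 b.linearIndependent _ hs μ₀)
    have hle := hU.mul_card_le (T := {P}) (M := p) (fun m hm => factorial_ne_zero_of_lt hm)
      (by simpa using hS P hPS) (∑ μ, P (h μ) • b μ).2 (fun h => hf0 (Subtype.ext h)) (by
        intro Q hQ m hm
        obtain rfl := Finset.mem_singleton.1 hQ
        have h1 := hPΦ Q m
        rw [h0, iterate_map_zero, map_zero] at h1
        rw [h1, Submodule.coe_sum, iterate_derivation_sum, map_sum]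
        refine Finset.sum_congr rfl fun μ _ => ?_
        have : δ^[m] ((Q (h μ) • b μ : U a) : R) = Q (h μ) • δ^[m] (b μ : R) := by
          rw [← Derivation.coeFn_coe, ← Module.End.pow_apply, ← Module.End.pow_apply]
          exact map_smul _ _ _
        rw [this, map_smul, smul_eq_mul, mul_comm])
    rw [Finset.card_singleton, mul_one] at hle
    omega
  have hle := hU.mul_card_le (fun m hm => factorial_ne_zero_of_lt (by omega)) hS hΦU hΦ0 hvan
  rw [mul_assoc] at hle
  have := Nat.le_of_mul_le_mul_left hle hD
  omega

end ZMod

/-- Stepanov's bound: the number of rational points where `δ` is nonzero is at most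
`(1 + ε) * p`, uniformly once `p` is large in terms of `ε`, `D` and `c`. -/
theorem IsCurveFiltration.exists_card_le {D c : ℕ} (hD : 0 < D) {ε : ℝ} (hε : 0 < ε) :
    ∃ p₀ : ℕ, ∀ p > p₀, ∀ [Fact p.Prime] (R : Type) [CommRing R] [IsDomain R] [Algebra (ZMod p) R]
      (δ : Derivation (ZMod p) R R) (U : ℕ → Submodule (ZMod p) R),
      IsCurveFiltration δ D c U → ∀ S : Finset (R →ₐ[ZMod p] ZMod p),
      (∀ P ∈ S, ∃ u, P u = 0 ∧ P (δ u) ≠ 0) → (S.card : ℝ) ≤ (1 + ε) * p := by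
  obtain ⟨B, hB⟩ := exists_nat_gt (2 * (1 + c) / ε)
  rw [div_lt_iff₀ hε] at hB
  have hB0 : 0 < B := by
    rcases Nat.eq_zero_or_pos B with rfl | h
    · have : (0 : ℝ) ≤ c := c.cast_nonneg
      norm_num at hB
      linarith
    · exact h
  set w := B * (D * B * c + B + c) with hw
  refine ⟨D * (c + 1 + w) + D * (B + c), fun p hp _ R _ _ _ δ U hU S hS => ?_⟩
  have hp2 : 2 ≤ p := (Fact.out : p.Prime).two_le
  by_cases hSc : D * (B + c) < S.card
  · have hdiv : c + 1 + w ≤ p / D := (Nat.le_div_iff_mul_le hD).2 (by rw [mul_comm]; omega)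
    obtain ⟨a, ha⟩ := Nat.exists_eq_add_of_le (show c + 1 ≤ p / D by omega)
    have hDp : D * (a + c) + D ≤ p := by
      refine le_trans (le_of_eq ?_) (Nat.mul_div_le p D)
      rw [ha]; ring
    have hDB : D * B ≤ p := by nlinarith
    have hmain := hU.mul_card_le_of_separated hD hS (a := a) (B := B) (by omega) hDB
      (by omega) hSc
    have hap : a ≤ p := by nlinarith
    have hmain' : B * S.card ≤ p + p * B + p * c + 2 * c := by omega
    have hr : (B : ℝ) * S.card ≤ p + p * B + p * c + 2 * c := by exact_mod_cast hmain'
    have hp2' : (2 : ℝ) ≤ p := by exact_mod_cast hp2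
    have hc : (0 : ℝ) ≤ c := c.cast_nonneg
    have hB0' : (0 : ℝ) < B := by exact_mod_cast hB0
    refine le_of_mul_le_mul_left ?_ hB0'
    nlinarith [mul_nonneg hc (sub_nonneg.2 hp2'), mul_le_mul_of_nonneg_right hB.le
      (by linarith : (0 : ℝ) ≤ p)]
  · have h1 : (S.card : ℝ) ≤ p := by exact_mod_cast (by omega : S.card ≤ p)
    have h2 : (0 : ℝ) ≤ ε * p := by positivity
    linarith

end Stepanov

section Curve

variable {K : Type*} [Field K]

/-- The polynomial `f(Y) - g(X)`. -/
noncomputable def sepPoly (f g : K[X]) : K[X][Y] := f.map C - C g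

/-- The derivation `f'(Y) ∂/∂X + g'(X) ∂/∂Y`, which kills `f(Y) - g(X)`. -/
noncomputable def hamiltonian (f g : K[X]) : Derivation K K[X][Y] K[X][Y] :=
  (derivative f).map C • Derivation.liftOfSurjective
      (f := (Bivariate.swap : K[X][Y] ≃ₐ[K] K[X][Y])) Bivariate.swap.surjective
      (d := (derivative' (R := K[X])).restrictScalars K) (fun x hx => by
        rw [(map_eq_zero_iff _ Bivariate.swap.injective).1 hx, map_zero, map_zero]) +
    C (derivative g) • (derivative' (R := K[X])).restrictScalars K

lemma hamiltonian_swap (f g : K[X]) (A : K[X][Y]) :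
    hamiltonian f g (Bivariate.swap A) = (derivative f).map C * Bivariate.swap (derivative A) +
      C (derivative g) * derivative (Bivariate.swap A) := by
  unfold hamiltonian
  rw [Derivation.add_apply, Derivation.smul_apply, Derivation.liftOfRightInverse_apply,
    Derivation.smul_apply]
  rfl

lemma hamiltonian_C (f g a : K[X]) :
    hamiltonian f g (C a) = (derivative f).map C * C (derivative a) := by
  have := hamiltonian_swap f g (a.map C)
  rw [Bivariate.swap_map_C, derivative_map, Bivariate.swap_map_C, derivative_C] at this
  rw [this, mul_zero, add_zero]

lemma hamiltonian_map_C (f g a : K[X]) :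
    hamiltonian f g (a.map C) = C (derivative g) * (derivative a).map C := by
  have := hamiltonian_swap f g (C a)
  rw [Bivariate.swap_C, derivative_map, derivative_C, map_zero] at this
  rw [this, mul_zero, zero_add]

lemma hamiltonian_X (f g : K[X]) : hamiltonian f g Y = C (derivative g) := by
  have := hamiltonian_map_C f g X
  simpa using this

lemma hamiltonian_sepPoly (f g : K[X]) : hamiltonian f g (sepPoly f g) = 0 := by
  rw [sepPoly, map_sub, hamiltonian_C, hamiltonian_map_C]
  ring

/-- The quotient map onto the coordinate ring of `f(Y) = g(X)`. -/
noncomputable def curveMk (f g : K[X]) : K[X][Y] →ₐ[K] AdjoinRoot (sepPoly f g) :=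
  (AdjoinRoot.mkₐ (sepPoly f g)).restrictScalars K

/-- The derivation induced by `hamiltonian` on the coordinate ring of `f(Y) = g(X)`. -/
noncomputable def curveDeriv (f g : K[X]) :
    Derivation K (AdjoinRoot (sepPoly f g)) (AdjoinRoot (sepPoly f g)) :=
  Derivation.liftOfSurjective (f := curveMk f g) AdjoinRoot.mk_surjective
    (d := hamiltonian f g) fun A hA => by
      obtain ⟨B, rfl⟩ := AdjoinRoot.mk_eq_zero.1 hA
      rw [Derivation.leibniz, hamiltonian_sepPoly, smul_zero, add_zero, smul_eq_mul, map_mul]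
      exact mul_eq_zero_of_left AdjoinRoot.mk_self _

lemma curveDeriv_mk (f g : K[X]) (A : K[X][Y]) :
    curveDeriv f g (AdjoinRoot.mk _ A) = AdjoinRoot.mk _ (hamiltonian f g A) :=
  by
  unfold curveDeriv
  exact Derivation.liftOfSurjective_apply (f := curveMk f g) AdjoinRoot.mk_surjective _ A

/-- The class of `a(X) * Y ^ l` in the coordinate ring of `f(Y) = g(X)`. -/
noncomputable def curveMonomial (f g : K[X]) (l : ℕ) : K[X] →ₗ[K] AdjoinRoot (sepPoly f g) :=
  (curveMk f g).toLinearMap ∘ₗ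
    ((monomial l : K[X] →ₗ[K[X]] K[X][Y]).restrictScalars K)

lemma curveMonomial_apply (f g a : K[X]) (l : ℕ) :
    curveMonomial f g l a = AdjoinRoot.mk _ (C a * X ^ l) := by
  rw [C_mul_X_pow_eq_monomial]
  rfl

/-- The parametrization of the functions of `X`-degree at most `d` on the curve `f(Y) = g(X)`. -/
noncomputable def curveParam (f g : K[X]) (d : ℕ) :
    (Fin f.natDegree → degreeLT K (d + 1)) →ₗ[K] AdjoinRoot (sepPoly f g) :=
  ∑ l : Fin f.natDegree, curveMonomial f g l ∘ₗ (degreeLT K (d + 1)).subtype ∘ₗ LinearMap.proj l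

lemma curveParam_apply (f g : K[X]) (d : ℕ) (v : Fin f.natDegree → degreeLT K (d + 1)) :
    curveParam f g d v = ∑ l : Fin f.natDegree, curveMonomial f g l (v l) := by
  simp [curveParam, LinearMap.sum_apply]

/-- The filtration of the coordinate ring of `f(Y) = g(X)` by `X`-degree. -/
noncomputable def curveFiltration (f g : K[X]) (d : ℕ) : Submodule K (AdjoinRoot (sepPoly f g)) :=
  LinearMap.range (curveParam f g d)

variable {f g : K[X]}

lemma curveParam_injective (hf : f.Monic) (hd : 0 < f.natDegree) (d : ℕ) :
    Function.Injective (curveParam f g d) := by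
  rw [← LinearMap.ker_eq_bot, LinearMap.ker_eq_bot']
  intro v hv
  set A : K[X][Y] := ∑ l : Fin f.natDegree, C (v l : K[X]) * X ^ (l : ℕ) with hA
  have hmk : AdjoinRoot.mk (sepPoly f g) A = 0 := by
    rw [hA, map_sum, ← hv, curveParam_apply]
    exact Finset.sum_congr rfl fun l _ => (curveMonomial_apply f g _ _).symm
  have hFm : (sepPoly f g).Monic := monic_map_C_sub_C hf hd g
  have hdeg : A.degree < (sepPoly f g).degree := by
    rw [degree_eq_natDegree hFm.ne_zero, sepPoly, natDegree_map_C_sub_C]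
    exact degree_sum_fin_lt _
  have hA0 : A = 0 := eq_zero_of_dvd_of_degree_lt (AdjoinRoot.mk_eq_zero.1 hmk) hdeg
  funext l
  have := congrArg (fun B => coeff B (l : ℕ)) hA0
  simp only [hA, finsetSum_coeff, coeff_C_mul, coeff_X_pow, coeff_zero, mul_ite, mul_one,
    mul_zero, Fin.val_inj, Finset.sum_ite_eq, Finset.mem_univ, if_true] at this
  exact Subtype.ext this

lemma curveFiltration_mono : Monotone (curveFiltration f g) := by
  rintro d e hde _ ⟨v, rfl⟩
  refine ⟨fun l => ⟨v l, degreeLT_mono (by omega) (v l).2⟩, ?_⟩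
  simp only [curveParam_apply]

lemma curveMonomial_mem_of_lt {a : K[X]} {d l : ℕ} (ha : a.natDegree ≤ d) (hl : l < f.natDegree) :
    curveMonomial f g l a ∈ curveFiltration f g d := by
  classical
  have ha' : a ∈ degreeLT K (d + 1) := by
    exact mem_degreeLT.2 (Order.lt_succ_iff.2 (natDegree_le_iff_degree_le.1 ha))
  refine ⟨Pi.single ⟨l, hl⟩ ⟨a, ha'⟩, ?_⟩
  rw [curveParam_apply, Finset.sum_eq_single ⟨l, hl⟩]
  · simp
  · intro k _ hk
    simp [Pi.single_eq_of_ne hk]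
  · simp

lemma curveMonomial_mem (hf : f.Monic) (hd : 0 < f.natDegree) {a : K[X]} {d : ℕ}
    (ha : a.natDegree ≤ d) (l : ℕ) :
    curveMonomial f g l a ∈ curveFiltration f g (d + g.natDegree * l) := by
  induction l using Nat.strong_induction_on generalizing a d with
  | _ l ih =>
    rcases lt_or_ge l f.natDegree with hl | hl
    · exact curveFiltration_mono (by omega) (curveMonomial_mem_of_lt ha hl)
    · obtain ⟨k, rfl⟩ := Nat.exists_eq_add_of_le' hl
      have hY : AdjoinRoot.mk (sepPoly f g) (X ^ f.natDegree) = AdjoinRoot.mk (sepPoly f g)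
          (C g - ∑ r ∈ Finset.range f.natDegree, C (C (f.coeff r)) * X ^ r) := by
        rw [AdjoinRoot.mk_eq_mk]
        refine ⟨1, ?_⟩
        rw [sepPoly, mul_one]
        conv_rhs => rw [hf.as_sum]
        simp only [Polynomial.map_add, Polynomial.map_pow, map_X, Polynomial.map_sum,
          Polynomial.map_mul, map_C]
        ring
      have hexp : curveMonomial f g (k + f.natDegree) a = curveMonomial f g k (a * g) -
          ∑ r ∈ Finset.range f.natDegree, curveMonomial f g (k + r) (a * C (f.coeff r)) := by
        simp only [curveMonomial_apply]
        rw [pow_add, ← mul_assoc, map_mul, hY, ← map_mul, ← map_sum, ← map_sub]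
        refine congrArg (AdjoinRoot.mk (sepPoly f g)) ?_
        rw [mul_sub, Finset.mul_sum]
        simp only [C_mul, pow_add]
        refine congrArg₂ _ (by ring) (Finset.sum_congr rfl fun r _ => by ring)
      rw [hexp]
      refine Submodule.sub_mem _ ?_ (Submodule.sum_mem _ fun r hr => ?_)
      · refine curveFiltration_mono ?_ (ih k (by omega) (d := d + g.natDegree)
          (natDegree_mul_le.trans (by omega)))
        nlinarith
      · have hr' := Finset.mem_range.1 hr
        refine curveFiltration_mono ?_ (ih (k + r) (by omega) (d := d)
          (natDegree_mul_le.trans (by simpa using ha)))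
        have := Nat.mul_le_mul_left g.natDegree (show k + r ≤ k + f.natDegree by omega)
        omega

lemma curveFiltration_mul_mem (hf : f.Monic) (hd : 0 < f.natDegree) {d e : ℕ}
    {u v : AdjoinRoot (sepPoly f g)} (hu : u ∈ curveFiltration f g d)
    (hv : v ∈ curveFiltration f g e) :
    u * v ∈ curveFiltration f g (d + e + 2 * (g.natDegree * f.natDegree)) := by
  obtain ⟨a, rfl⟩ := hu
  obtain ⟨b, rfl⟩ := hv
  rw [curveParam_apply, curveParam_apply, Finset.sum_mul_sum]
  refine Submodule.sum_mem _ fun l _ => Submodule.sum_mem _ fun m _ => ?_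
  have h : curveMonomial f g l (a l) * curveMonomial f g m (b m) =
      curveMonomial f g (l + m) (a l * b m : K[X]) := by
    simp only [curveMonomial_apply]
    rw [← map_mul, C_mul, pow_add]
    refine congrArg (AdjoinRoot.mk (sepPoly f g)) ?_
    ring
  have hdeg : ∀ {n : ℕ} (w : degreeLT K (n + 1)), (w : K[X]).natDegree ≤ n := by
    intro n w
    exact natDegree_le_iff_degree_le.2 (Order.lt_succ_iff.1 (mem_degreeLT.1 w.2))
  rw [h]
  refine curveFiltration_mono ?_ (curveMonomial_mem hf hd
    (natDegree_mul_le.trans (Nat.add_le_add (hdeg (a l)) (hdeg (b m)))) _)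
  have := Nat.mul_le_mul_left g.natDegree (show (l : ℕ) + m ≤ 2 * f.natDegree by omega)
  linarith

lemma curveFiltration_deriv_mem (hf : f.Monic) (hd : 0 < f.natDegree) {d : ℕ}
    {u : AdjoinRoot (sepPoly f g)} (hu : u ∈ curveFiltration f g d) :
    curveDeriv f g u ∈ curveFiltration f g (d + 4 * (g.natDegree * f.natDegree)) := by
  obtain ⟨a, rfl⟩ := hu
  rw [curveParam_apply, map_sum]
  refine Submodule.sum_mem _ fun l _ => ?_
  have hal : (a l : K[X]).natDegree ≤ d :=
    natDegree_le_iff_degree_le.2 (Order.lt_succ_iff.1 (mem_degreeLT.1 (a l).2))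
  have hg : g.natDegree ≤ g.natDegree * f.natDegree := Nat.le_mul_of_pos_right _ hd
  have hder : AdjoinRoot.mk (sepPoly f g) ((derivative f).map C) ∈
      curveFiltration f g (g.natDegree * f.natDegree) := by
    rw [as_sum_range_C_mul_X_pow (derivative f), Polynomial.map_sum, map_sum]
    refine Submodule.sum_mem _ fun r hr => ?_
    have h1 := Finset.mem_range.1 hr
    have h2 := natDegree_derivative_lt hd.ne'
    have h3 := curveMonomial_mem_of_lt (f := f) (g := g) (a := C ((derivative f).coeff r))
      (natDegree_C _).le (show r < f.natDegree by omega)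
    rw [curveMonomial_apply] at h3
    simpa using curveFiltration_mono (Nat.zero_le _) h3
  have h : curveDeriv f g (curveMonomial f g l (a l)) =
      curveMonomial f g l (derivative (a l : K[X])) *
        AdjoinRoot.mk (sepPoly f g) ((derivative f).map C) +
      curveMonomial f g (l - 1) (((l : ℕ) : K[X]) * (a l : K[X])) *
        curveMonomial f g 0 (derivative g) := by
    simp only [curveMonomial_apply]
    rw [curveDeriv_mk, Derivation.leibniz, Derivation.leibniz_pow, hamiltonian_C, hamiltonian_X,
      ← map_mul, ← map_mul, ← map_add]
    refine congrArg (AdjoinRoot.mk (sepPoly f g)) ?_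
    simp only [smul_eq_mul, nsmul_eq_mul, C_mul, map_natCast, pow_zero, mul_one]
    ring
  rw [h]
  refine Submodule.add_mem _ ?_ ?_
  · refine curveFiltration_mono ?_ (curveFiltration_mul_mem hf hd (curveMonomial_mem_of_lt
      (d := d) ((natDegree_derivative_le _).trans (by omega)) l.2) hder)
    omega
  · refine curveFiltration_mono ?_ (curveFiltration_mul_mem hf hd (curveMonomial_mem_of_lt
      (d := d) (natDegree_mul_le.trans (by simpa using hal)) (by omega)) (curveMonomial_mem_of_lt
      (d := g.natDegree) ((natDegree_derivative_le _).trans (by omega)) hd))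
    omega

lemma isCurveFiltration (hf : f.Monic) (hd : 0 < f.natDegree) :
    IsCurveFiltration (curveDeriv f g) f.natDegree (4 * (g.natDegree * f.natDegree))
      (curveFiltration f g) where
  mono := curveFiltration_mono
  exists_mem u := by
    obtain ⟨A, rfl⟩ := AdjoinRoot.mk_surjective u
    induction A using Polynomial.induction_on' with
    | add A B hA hB =>
      obtain ⟨d, hA⟩ := hA
      obtain ⟨e, hB⟩ := hB
      refine ⟨max d e, ?_⟩
      rw [map_add]
      exact Submodule.add_mem _ (curveFiltration_mono (le_max_left d e) hA)
        (curveFiltration_mono (le_max_right d e) hB)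
    | monomial l a => exact ⟨_, curveMonomial_mem hf hd le_rfl l⟩
  finite d := by
    have := Module.Finite.equiv (degreeLTEquiv K (d + 1)).symm
    exact Module.Finite.range (curveParam f g d)
  finrank_eq d := by
    have := Module.Finite.equiv (degreeLTEquiv K (d + 1)).symm
    rw [curveFiltration, LinearMap.finrank_range_of_inj (curveParam_injective hf hd d),
      Module.finrank_pi_fintype]
    simp [(degreeLTEquiv K (d + 1)).finrank_eq]
  mul_mem hu hv := curveFiltration_mono (by omega) (curveFiltration_mul_mem hf hd hu hv)
  deriv_mem hu := curveFiltration_deriv_mem hf hd hu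

end Curve

section Points

/-- Evaluation at a point of the curve `f(Y) = g(X)`. -/
noncomputable def curvePoint {K : Type*} [Field K] (f g : K[X]) (z : K × K)
    (hz : f.eval z.2 = g.eval z.1) : AdjoinRoot (sepPoly f g) →ₐ[K] K :=
  AdjoinRoot.liftAlgHom (sepPoly f g) (aeval z.1) z.2 (by
    change eval₂ (evalRingHom z.1) z.2 _ = 0
    rw [eval₂_evalRingHom, sepPoly, evalEval_sub, evalEval_map_C, evalEval_C, hz, sub_self])

lemma curvePoint_mk {K : Type*} [Field K] {f g : K[X]} {z : K × K}
    (hz : f.eval z.2 = g.eval z.1) (A : K[X][Y]) :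
    curvePoint f g z hz (AdjoinRoot.mk _ A) = A.evalEval z.1 z.2 := by
  rw [curvePoint, AdjoinRoot.liftAlgHom_mk, ← eval₂_evalRingHom]
  rfl

/-- The number of points on an irreducible curve `f(Y) = g(X)` over `𝔽_p`. -/
theorem exists_card_points_le {D n : ℕ} (hD : 0 < D) (hn : 0 < n) {ε : ℝ} (hε : 0 < ε) :
    ∃ p₀ : ℕ, ∀ p > p₀, ∀ [Fact p.Prime] (f g : (ZMod p)[X]), f.Monic → f.natDegree = D →
      g.natDegree = n → Irreducible (sepPoly f g) →
      ((Finset.univ.filter fun z : ZMod p × ZMod p => f.eval z.2 = g.eval z.1).card : ℝ) ≤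
        (1 + ε) * p := by
  classical
  obtain ⟨p₁, hp₁⟩ := IsCurveFiltration.exists_card_le (c := 4 * (n * D)) hD (half_pos hε)
  obtain ⟨p₂, hp₂⟩ := exists_nat_gt (D * n / (ε / 2))
  rw [div_lt_iff₀ (half_pos hε)] at hp₂
  refine ⟨max p₁ (max p₂ D), fun p hp _ f g hf hfD hgn hirr => ?_⟩
  have : IsDomain (AdjoinRoot (sepPoly f g)) := AdjoinRoot.isDomain_of_prime hirr.prime
  set Z := Finset.univ.filter fun z : ZMod p × ZMod p => f.eval z.2 = g.eval z.1 with hZ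
  set G := Z.filter fun z => (derivative f).eval z.2 ≠ 0 with hG
  have hGz : ∀ z : G, f.eval z.1.2 = g.eval z.1.1 := fun z =>
    (Finset.mem_filter.1 (Finset.mem_filter.1 z.2).1).2
  have hinj : Function.Injective fun z : G => curvePoint f g z.1 (hGz z) := by
    intro z w hzw
    refine Subtype.ext (Prod.ext ?_ ?_)
    · have := congrArg (fun P => P (AdjoinRoot.mk _ (C X))) hzw
      simpa only [curvePoint_mk, evalEval_C, eval_X] using this
    · have := congrArg (fun P => P (AdjoinRoot.mk _ Y)) hzw
      simpa only [curvePoint_mk, evalEval_X] using this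
  have hGcard : (G.card : ℝ) ≤ (1 + ε / 2) * p := by
    have hU := isCurveFiltration (g := g) hf (hfD ▸ hD)
    rw [hfD, hgn] at hU
    have := hp₁ p (by omega) _ (curveDeriv f g) (curveFiltration f g) hU
      (Finset.univ.image fun z : G => curvePoint f g z.1 (hGz z)) (by
        intro P hP
        obtain ⟨z, -, rfl⟩ := Finset.mem_image.1 hP
        refine ⟨AdjoinRoot.mk _ (C (X - C z.1.1)), ?_, ?_⟩
        · rw [curvePoint_mk, evalEval_C, eval_sub, eval_X, eval_C, sub_self]
        · rw [curveDeriv_mk, hamiltonian_C, curvePoint_mk, derivative_X_sub_C, C_1, mul_one,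
            evalEval_map_C]
          exact (Finset.mem_filter.1 z.2).2)
    rwa [Finset.card_image_of_injective _ hinj, Finset.card_univ, Fintype.card_coe] at this
  have hder : derivative f ≠ 0 := by
    intro h
    have h1 := congrArg (fun q => coeff q (D - 1)) h
    simp only [coeff_derivative, coeff_zero] at h1
    rw [Nat.sub_add_cancel hD, ← hfD, hf.coeff_natDegree, one_mul, hfD] at h1
    have h2 : ((D : ℕ) : ZMod p) = 0 := by
      rw [← h1, ← Nat.cast_add_one, Nat.sub_add_cancel hD]
    rw [ZMod.natCast_eq_zero_iff] at h2
    have := Nat.le_of_dvd hD h2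
    omega
  have hbad : (Z.filter fun z => ¬ (derivative f).eval z.2 ≠ 0).card ≤ n * D := by
    refine (Finset.card_le_mul_card_image (f := Prod.snd) _ n ?_).trans
      (Nat.mul_le_mul_left n ?_)
    · intro y hy
      have hg0 : g - C (f.eval y) ≠ 0 := by
        intro h
        rw [sub_eq_zero.1 h, natDegree_C] at hgn
        omega
      have hcard : (g - C (f.eval y)).roots.toFinset.card ≤ n := by
        refine (Multiset.toFinset_card_le _).trans ((card_roots' _).trans ?_)
        rw [natDegree_sub_C, hgn]
      refine le_trans (Finset.card_le_card_of_injOn Prod.fst ?_ ?_) hcard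
      · intro z hz
        obtain ⟨h1, h2⟩ := Finset.mem_filter.1 hz
        have h3 := (Finset.mem_filter.1 (Finset.mem_filter.1 h1).1).2
        rw [Finset.mem_coe, Multiset.mem_toFinset, mem_roots hg0, IsRoot.def, eval_sub, eval_C,
          ← h2, h3, sub_self]
      · intro z hz w hw h
        exact Prod.ext h ((Finset.mem_filter.1 hz).2.trans (Finset.mem_filter.1 hw).2.symm)
    · have hcard : (derivative f).roots.toFinset.card ≤ D := by
        refine (Multiset.toFinset_card_le _).trans ((card_roots' _).trans ?_)
        have := natDegree_derivative_le f
        omega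
      refine le_trans (Finset.card_le_card ?_) hcard
      intro y hy
      obtain ⟨z, hz, rfl⟩ := Finset.mem_image.1 hy
      simpa [mem_roots hder] using (Finset.mem_filter.1 hz).2
  have hsplit := Finset.card_filter_add_card_filter_not (s := Z)
    (fun z => (derivative f).eval z.2 ≠ 0)
  have hZle : (Z.card : ℝ) ≤ G.card + n * D := by
    rw [← hsplit]
    exact_mod_cast Nat.add_le_add_left hbad _
  have hpp : (p₂ : ℝ) ≤ p := by exact_mod_cast (by omega : p₂ ≤ p)
  nlinarith

end Points

section ShiftedProducts

variable {K : Type*} [Field K]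

/-- The polynomial `z (z + 1) ⋯ (z + 2 * j - 1)` centred so that it is even in `X`. -/
noncomputable def evenPoly (K : Type*) [Field K] (j : ℕ) : K[X] :=
  ∏ s ∈ Finset.range (2 * j), (X - C ((s : K) - j + 2⁻¹))

lemma evenPoly_monic (j : ℕ) : (evenPoly K j).Monic :=
  monic_prod_of_monic _ _ fun _ _ => monic_X_sub_C _

lemma natDegree_evenPoly (j : ℕ) : (evenPoly K j).natDegree = 2 * j := by
  rw [evenPoly, natDegree_finsetProd_X_sub_C_eq_card, Finset.card_range]

lemma evenPoly_comp_neg (h2 : (2 : K) ≠ 0) (j : ℕ) :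
    (evenPoly K j).comp (-X) = evenPoly K j := by
  rw [evenPoly, prod_comp]
  have h : ∀ s ∈ Finset.range (2 * j), (X - C ((s : K) - j + 2⁻¹)).comp (-X) =
      (-1) * (X - C (((2 * j - 1 - s : ℕ) : K) - j + 2⁻¹)) := by
    intro s hs
    have hs' := Finset.mem_range.1 hs
    have hcast : ((2 * j - 1 - s : ℕ) : K) = 2 * j - 1 - s := by
      rw [Nat.sub_sub, Nat.cast_sub (by omega)]
      push_cast
      ring
    have hr : (s : K) - j + 2⁻¹ = -(((2 * j - 1 - s : ℕ) : K) - j + 2⁻¹) := by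
      rw [hcast]
      linear_combination mul_inv_cancel₀ h2
    rw [sub_comp, X_comp, C_comp, hr, C_neg]
    ring
  rw [Finset.prod_congr rfl h, Finset.prod_mul_distrib,
    Finset.prod_range_reflect fun s => X - C ((s : K) - j + 2⁻¹)]
  simp

lemma pow_mul_eval_evenPoly_zero (h2 : (2 : K) ≠ 0) (j : ℕ) :
    4 ^ j * (evenPoly K j).eval 0 =
      ((∏ s ∈ Finset.range (2 * j), (2 * (j : ℤ) - 1 - 2 * s) : ℤ) : K) := by
  have h4 : (4 : K) ^ j = ∏ _s ∈ Finset.range (2 * j), 2 := by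
    rw [Finset.prod_const, Finset.card_range, pow_mul]
    norm_num
  rw [h4, evenPoly, eval_prod, ← Finset.prod_mul_distrib]
  push_cast
  refine Finset.prod_congr rfl fun s _ => ?_
  rw [eval_sub, eval_X, eval_C]
  linear_combination -mul_inv_cancel₀ h2

lemma odd_prod_central (j : ℕ) :
    Odd (∏ s ∈ Finset.range (2 * j), (2 * (j : ℤ) - 1 - 2 * s)) :=
  Finset.prod_induction _ Odd (fun _ _ => Odd.mul) odd_one fun s _ =>
    ⟨(j : ℤ) - 1 - s, by ring⟩

lemma pow_mul_ne_pow_mul_of_odd {a b : ℤ} (hb : Odd b) {i j : ℕ} (hij : i < j) :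
    4 ^ j * a ≠ 4 ^ i * b := by
  intro h
  obtain ⟨k, rfl⟩ := Nat.exists_eq_add_of_lt hij
  rw [add_assoc, pow_add, mul_assoc] at h
  have h' := mul_left_cancel₀ (pow_ne_zero i (by norm_num : (4 : ℤ) ≠ 0)) h
  rw [← h', pow_succ] at hb
  exact Int.not_even_iff_odd.2 hb ⟨4 ^ k * 2 * a, by ring⟩

lemma eventually_eval_evenPoly_zero_ne {i j : ℕ} (hij : i ≠ j) :
    ∀ᶠ p : ℕ in Filter.atTop, ∀ [Fact p.Prime],
      (evenPoly (ZMod p) i).eval 0 ≠ (evenPoly (ZMod p) j).eval 0 := by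
  wlog h : i < j generalizing i j
  · filter_upwards [this hij.symm (by omega)] with p hp _ using hp.symm
  set m : ℤ := 4 ^ j * ∏ s ∈ Finset.range (2 * i), (2 * (i : ℤ) - 1 - 2 * s) -
    4 ^ i * ∏ s ∈ Finset.range (2 * j), (2 * (j : ℤ) - 1 - 2 * s) with hm
  have hm0 : m ≠ 0 := sub_ne_zero.2
    (pow_mul_ne_pow_mul_of_odd (odd_prod_central j) h)
  filter_upwards [Filter.eventually_gt_atTop m.natAbs, Filter.eventually_gt_atTop 2] with p hp hp2
  intro _ heq
  have h2 : (2 : ZMod p) ≠ 0 := by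
    have := (ZMod.natCast_eq_zero_iff 2 p).not.2 (Nat.not_dvd_of_pos_of_lt two_pos hp2)
    exact_mod_cast this
  have hzero : (m : ZMod p) = 0 := by
    rw [hm, Int.cast_sub, Int.cast_mul, Int.cast_mul, ← pow_mul_eval_evenPoly_zero h2,
      ← pow_mul_eval_evenPoly_zero h2, heq]
    push_cast
    ring
  rw [ZMod.intCast_zmod_eq_zero_iff_dvd, Int.natCast_dvd] at hzero
  exact absurd (Nat.le_of_dvd (Int.natAbs_pos.2 hm0) hzero) (by omega)

lemma eventually_card_evenPoly_eq_le {i j : ℕ} (hi : Odd i) (hj : Odd j) (hij : i.Coprime j)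
    (hne : i ≠ j) {ε : ℝ} (hε : 0 < ε) :
    ∀ᶠ p : ℕ in Filter.atTop, ∀ [Fact p.Prime],
      ((Finset.univ.filter fun z : ZMod p × ZMod p =>
        (evenPoly (ZMod p) i).eval z.2 = (evenPoly (ZMod p) j).eval z.1).card : ℝ) ≤
        (1 + ε) * p := by
  classical
  obtain ⟨p₀, hp₀⟩ := exists_card_points_le (D := 2 * i) (n := 2 * j) (by have := hi.pos; omega)
    (by have := hj.pos; omega) hε
  filter_upwards [Filter.eventually_gt_atTop p₀, Filter.eventually_gt_atTop 2,
    Filter.eventually_gt_atTop (2 * i), Filter.eventually_gt_atTop (2 * j),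
    eventually_eval_evenPoly_zero_ne hne] with p h₀ hp2 hpi hpj hev
  intro _
  have h2 : (2 : ZMod p) ≠ 0 := by
    have := (ZMod.natCast_eq_zero_iff 2 p).not.2 (Nat.not_dvd_of_pos_of_lt two_pos hp2)
    exact_mod_cast this
  have hroots : ∀ k : ℕ, 2 * k < p → ∃ s : Finset (ZMod p), s.card = 2 * k ∧
      evenPoly (ZMod p) k = ∏ r ∈ s, (X - C r) := by
    intro k hk
    have hinj : Set.InjOn (fun s : ℕ => (s : ZMod p) - k + 2⁻¹) (Finset.range (2 * k)) := by
      intro s hs t ht hst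
      have hs' := Finset.mem_range.1 hs
      have ht' := Finset.mem_range.1 ht
      have hst' : (s : ZMod p) = t := by linear_combination hst
      rw [ZMod.natCast_eq_natCast_iff', Nat.mod_eq_of_lt (by omega),
        Nat.mod_eq_of_lt (by omega)] at hst'
      exact hst'
    refine ⟨(Finset.range (2 * k)).image fun s : ℕ => (s : ZMod p) - k + 2⁻¹, ?_, ?_⟩
    · rw [Finset.card_image_of_injOn hinj, Finset.card_range]
    · rw [Finset.prod_image hinj]
      rfl
  obtain ⟨s, hs, hfs⟩ := hroots i hpi
  obtain ⟨t, ht, hgt⟩ := hroots j hpj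
  exact hp₀ p h₀ _ _ (evenPoly_monic i) (natDegree_evenPoly i) (natDegree_evenPoly j)
    (irreducible_map_C_sub_C h2 hi hj hij hs ht hfs hgt (evenPoly_comp_neg h2 i)
      (evenPoly_comp_neg h2 j) hev)

end ShiftedProducts

section SecondMoment

lemma exists_oddPrimes_sum_ge (B : ℝ) :
    ∃ J : Finset ℕ, (∀ j ∈ J, j.Prime ∧ j ≠ 2) ∧ B ≤ ∑ j ∈ J, (1 : ℝ) / j := by
  have hnonneg : ∀ n, 0 ≤ Set.indicator {q : ℕ | q.Prime} (fun n : ℕ => (1 : ℝ) / n) n :=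
    fun n => Set.indicator_nonneg (fun _ _ => by positivity) n
  have htend := (not_summable_iff_tendsto_nat_atTop_of_nonneg hnonneg).1
    not_summable_one_div_on_primes
  obtain ⟨n, hn⟩ := (htend.eventually_ge_atTop (B + 1)).exists
  refine ⟨((Finset.range n).filter Nat.Prime).erase 2, fun j hj => ?_, ?_⟩
  · obtain ⟨h1, h2⟩ := Finset.mem_erase.1 hj
    exact ⟨(Finset.mem_filter.1 h2).2, h1⟩
  · have h1 : ∑ k ∈ Finset.range n, Set.indicator {q : ℕ | q.Prime} (fun n : ℕ => (1 : ℝ) / n) k =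
        ∑ k ∈ (Finset.range n).filter Nat.Prime, (1 : ℝ) / k := by
      rw [Finset.sum_filter]
      exact Finset.sum_congr rfl fun k _ => by simp [Set.indicator_apply]
    rw [h1] at hn
    by_cases h2 : 2 ∈ (Finset.range n).filter Nat.Prime
    · rw [← Finset.add_sum_erase _ _ h2] at hn
      norm_num at hn ⊢
      linarith
    · rw [Finset.erase_eq_of_notMem h2]
      linarith

/-- Second moment method: `card {x | N x = 0}` is small when `N` has small variance. -/
lemma card_mul_sq_le {α : Type*} [Fintype α] [DecidableEq α] (J : Finset ℕ) (N : ℕ → α → ℝ)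
    {ε : ℝ} (hε : 0 ≤ ε) (hpos : ∀ j ∈ J, 0 < j)
    (hmean : ∀ j ∈ J, ∑ x, N j x = Fintype.card α)
    (hdiag : ∀ j ∈ J, ∑ x, N j x * N j x ≤ 2 * j * Fintype.card α)
    (hoff : ∀ i ∈ J, ∀ j ∈ J, i ≠ j → ∑ x, N i x * N j x ≤ (1 + ε) * Fintype.card α)
    {W : Finset α} (hW : ∀ x ∈ W, ∀ j ∈ J, N j x = 0) :
    W.card * (∑ j ∈ J, (1 : ℝ) / j) ^ 2 ≤
      (ε * (∑ j ∈ J, (1 : ℝ) / j) ^ 2 + 2 * ∑ j ∈ J, (1 : ℝ) / j) * Fintype.card α := by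
  set S := ∑ j ∈ J, (1 : ℝ) / j with hS
  set n := (Fintype.card α : ℝ) with hn
  have hn0 : 0 ≤ n := Nat.cast_nonneg _
  let T : α → ℝ := fun x => ∑ j ∈ J, 1 / (j : ℝ) * N j x
  have hT1 : ∑ x, T x = S * n := by
    simp only [T]
    rw [Finset.sum_comm, hS, Finset.sum_mul]
    refine Finset.sum_congr rfl fun j hj => ?_
    rw [← Finset.mul_sum, hmean j hj]
  have hT2 : ∑ x, T x ^ 2 ≤ (1 + ε) * S ^ 2 * n + 2 * S * n := by
    have hexp : ∑ x, T x ^ 2 =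
        ∑ i ∈ J, ∑ j ∈ J, 1 / (i : ℝ) * (1 / j) * ∑ x, N i x * N j x := by
      have h : ∀ x, T x ^ 2 =
          ∑ i ∈ J, ∑ j ∈ J, 1 / (i : ℝ) * (1 / j) * (N i x * N j x) := fun x => by
        rw [sq, Finset.sum_mul_sum]
        exact Finset.sum_congr rfl fun i _ => Finset.sum_congr rfl fun j _ => by ring
      simp only [h, Finset.mul_sum]
      rw [Finset.sum_comm]
      exact Finset.sum_congr rfl fun i _ => Finset.sum_comm
    have hterm : ∀ i ∈ J, ∀ j ∈ J, 1 / (i : ℝ) * (1 / j) * ∑ x, N i x * N j x ≤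
        1 / (i : ℝ) * (1 / j) * ((1 + ε) * n) + if i = j then 1 / (i : ℝ) * (2 * n) else 0 := by
      intro i hi j hj
      have hi0 : (0 : ℝ) < i := by exact_mod_cast hpos i hi
      have hj0 : (0 : ℝ) < j := by exact_mod_cast hpos j hj
      split_ifs with h
      · subst h
        have h1 := mul_le_mul_of_nonneg_left (hdiag i hi)
          (by positivity : 0 ≤ 1 / (i : ℝ) * (1 / i))
        have h2 : 1 / (i : ℝ) * (1 / i) * (2 * i * n) = 1 / (i : ℝ) * (2 * n) := by field_simp
        have h3 : 0 ≤ 1 / (i : ℝ) * (1 / i) * ((1 + ε) * n) := by positivity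
        linarith
      · rw [add_zero]
        exact mul_le_mul_of_nonneg_left (hoff i hi j hj h) (by positivity)
    rw [hexp]
    refine (Finset.sum_le_sum fun i hi => Finset.sum_le_sum (hterm i hi)).trans (le_of_eq ?_)
    simp only [Finset.sum_add_distrib, Finset.sum_ite_eq]
    congr 1
    · rw [sq, hS, Finset.sum_mul_sum, mul_right_comm, mul_comm, Finset.mul_sum]
      simp only [Finset.mul_sum]
      exact Finset.sum_congr rfl fun i _ => Finset.sum_congr rfl fun j _ => by ring
    · rw [Finset.sum_ite_of_true (fun i hi => hi), ← Finset.sum_mul]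
      ring
  have hvar : ∑ x, (T x - S) ^ 2 ≤ (ε * S ^ 2 + 2 * S) * n := by
    have : ∑ x, (T x - S) ^ 2 = ∑ x, T x ^ 2 - 2 * S * ∑ x, T x + n * S ^ 2 := by
      simp only [sub_sq, Finset.sum_add_distrib, Finset.sum_sub_distrib, Finset.sum_const,
        Finset.card_univ, nsmul_eq_mul, Finset.mul_sum]
      congr 2
      exact Finset.sum_congr rfl fun x _ => by ring
    rw [this, hT1]
    linarith
  refine le_trans ?_ hvar
  have hle : ∑ x ∈ W, (T x - S) ^ 2 ≤ ∑ x, (T x - S) ^ 2 :=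
    Finset.sum_le_sum_of_subset_of_nonneg (Finset.subset_univ _) fun _ _ _ => sq_nonneg _
  refine le_trans (le_of_eq ?_) hle
  rw [← nsmul_eq_mul, ← Finset.sum_const]
  refine Finset.sum_congr rfl fun x hx => ?_
  have : T x = 0 := Finset.sum_eq_zero fun j hj => by rw [hW x hx j hj, mul_zero]
  rw [this]
  ring

/-- All but a small proportion of residues are values of some `evenPoly j` with `j` bounded. -/
theorem exists_evenPoly_values_dense {η : ℝ} (hη : 0 < η) :
    ∃ J : Finset ℕ, ∀ᶠ p : ℕ in Filter.atTop, ∀ [Fact p.Prime],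
      ∀ W : Finset (ZMod p),
        (∀ x ∈ W, ∀ j ∈ J, ∀ y, (evenPoly (ZMod p) j).eval y ≠ x) → (W.card : ℝ) ≤ η * p := by
  classical
  obtain ⟨J, hJ, hS⟩ := exists_oddPrimes_sum_ge (4 / η)
  set S := ∑ j ∈ J, (1 : ℝ) / j with hSdef
  have hS0 : 0 < S := lt_of_lt_of_le (by positivity) hS
  refine ⟨J, ?_⟩
  have hall : ∀ᶠ p : ℕ in Filter.atTop, ∀ i ∈ J, ∀ j ∈ J, i ≠ j → ∀ [Fact p.Prime],
      ((Finset.univ.filter fun z : ZMod p × ZMod p =>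
        (evenPoly (ZMod p) i).eval z.2 = (evenPoly (ZMod p) j).eval z.1).card : ℝ) ≤
        (1 + η / 2) * p := by
    refine (Filter.eventually_all_finset J).2 fun i hi =>
      (Filter.eventually_all_finset J).2 fun j hj => ?_
    by_cases hij : i = j
    · exact Filter.Eventually.of_forall fun p h => absurd hij h
    · filter_upwards [eventually_card_evenPoly_eq_le ((hJ i hi).1.odd_of_ne_two (hJ i hi).2)
        ((hJ j hj).1.odd_of_ne_two (hJ j hj).2)
        ((Nat.coprime_primes (hJ i hi).1 (hJ j hj).1).2 hij) hij (half_pos hη)] with p hp _ using hp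
  filter_upwards [hall] with p hp _ W hW
  let N : ℕ → ZMod p → ℕ := fun j x =>
    (Finset.univ.filter fun y => (evenPoly (ZMod p) j).eval y = x).card
  have hmean : ∀ j, ∑ x, N j x = p := by
    intro j
    have := Finset.card_eq_sum_card_fiberwise (s := (Finset.univ : Finset (ZMod p)))
      (t := Finset.univ) (f := fun y => (evenPoly (ZMod p) j).eval y) (fun _ _ => by simp)
    rw [Finset.card_univ, ZMod.card] at this
    exact this.symm
  have hN : ∀ j ∈ J, ∀ x, N j x ≤ 2 * j := by
    intro j hj x
    have hdeg : ((evenPoly (ZMod p) j) - C x).natDegree = 2 * j := by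
      rw [natDegree_sub_C, natDegree_evenPoly]
    have hne : (evenPoly (ZMod p) j) - C x ≠ 0 := by
      intro h
      rw [h, natDegree_zero] at hdeg
      have := (hJ j hj).1.pos
      omega
    refine le_trans (Finset.card_le_card (t := ((evenPoly (ZMod p) j) - C x).roots.toFinset) ?_)
      ((Multiset.toFinset_card_le _).trans ((card_roots' _).trans hdeg.le))
    intro y hy
    rw [Multiset.mem_toFinset, mem_roots hne, IsRoot.def, eval_sub, eval_C,
      (Finset.mem_filter.1 hy).2, sub_self]
  have hprod : ∀ i j, ∑ x, N i x * N j x = (Finset.univ.filter fun z : ZMod p × ZMod p =>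
      (evenPoly (ZMod p) i).eval z.2 = (evenPoly (ZMod p) j).eval z.1).card := by
    intro i j
    rw [Finset.card_eq_sum_card_fiberwise (t := Finset.univ)
      (f := fun z : ZMod p × ZMod p => (evenPoly (ZMod p) j).eval z.1) (fun _ _ => by simp)]
    refine Finset.sum_congr rfl fun x _ => ?_
    rw [mul_comm, ← Finset.card_product]
    congr 1
    ext z
    simp only [Finset.mem_product, Finset.mem_filter, Finset.mem_univ, true_and]
    constructor
    · rintro ⟨h1, h2⟩
      exact ⟨h2.trans h1.symm, h1⟩
    · rintro ⟨h1, h2⟩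
      exact ⟨h2, h1.trans h2⟩
  have hmain := card_mul_sq_le J (fun j x => (N j x : ℝ)) (half_pos hη).le
    (fun j hj => (hJ j hj).1.pos)
    (fun j _ => by rw [ZMod.card]; exact_mod_cast hmean j)
    (fun j hj => by
      rw [ZMod.card]
      have : ∑ x, N j x * N j x ≤ 2 * j * p := calc
        _ ≤ ∑ x, 2 * j * N j x := Finset.sum_le_sum fun x _ => Nat.mul_le_mul_right _ (hN j hj x)
        _ = 2 * j * p := by rw [← Finset.mul_sum, hmean j]
      exact_mod_cast this)
    (fun i hi j hj hij => by
      rw [ZMod.card]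
      have h1 := hp i hi j hj hij
      rw [← hprod i j] at h1
      exact_mod_cast h1)
    (W := W) (fun x hx j hj => by
      have : N j x = 0 := Finset.card_eq_zero.2
        (Finset.filter_eq_empty_iff.2 fun y _ => hW x hx j hj y)
      exact_mod_cast this)
  rw [ZMod.card, ← hSdef] at hmain
  have h4 : 4 ≤ η * S := by rwa [div_le_iff₀ hη, mul_comm] at hS
  refine le_of_mul_le_mul_right (hmain.trans ?_) (pow_pos hS0 2)
  have hp0 : (0 : ℝ) ≤ p := Nat.cast_nonneg p
  have h5 : 2 * S ≤ η / 2 * S ^ 2 := by nlinarith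
  nlinarith

end SecondMoment

section Counting

open scoped Nat

variable {p : ℕ} [Fact p.Prime]

lemma factorial_mul_factorial_compl {n : ℕ} (hn : n < p) :
    (n ! : ZMod p) * ((p - 1 - n)! : ZMod p) = (-1) ^ (n + 1) := by
  induction n with
  | zero => simp [ZMod.wilsons_lemma p]
  | succ n ih =>
    have ih := ih (by omega)
    obtain ⟨k, rfl⟩ := Nat.exists_eq_add_of_lt hn
    rw [show n + 1 + k + 1 - 1 - n = k + 1 by omega, Nat.factorial_succ] at ih
    rw [show n + 1 + k + 1 - 1 - (n + 1) = k by omega, Nat.factorial_succ]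
    have hp : ((n + 1 + k + 1 : ℕ) : ZMod (n + 1 + k + 1)) = 0 := ZMod.natCast_self _
    push_cast at ih hp ⊢
    linear_combination -ih + (n ! : ZMod (n + 1 + k + 1)) * k ! * hp

lemma factorial_cast_ne_zero {n : ℕ} (hn : n < p) : (n ! : ZMod p) ≠ 0 := fun h => by
  have := factorial_mul_factorial_compl hn
  rw [h, zero_mul] at this
  exact pow_ne_zero _ (neg_ne_zero.2 one_ne_zero) this.symm

lemma factorial_mem_factorialResidues {n : ℕ} (hn : n < p) :
    (n ! : ZMod p) ∈ factorialResidues p := by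
  have hp := (Fact.out : p.Prime).two_le
  refine Finset.mem_image.2 ?_
  rcases Nat.eq_zero_or_pos n with rfl | h
  · exact ⟨1, Finset.mem_Icc.2 ⟨le_rfl, by omega⟩, by simp⟩
  · exact ⟨n, Finset.mem_Icc.2 ⟨h, by omega⟩, rfl⟩

lemma ne_zero_of_mem_factorialResidues {a : ZMod p} (ha : a ∈ factorialResidues p) : a ≠ 0 := by
  have hp := (Fact.out : p.Prime).two_le
  obtain ⟨n, hn, rfl⟩ := Finset.mem_image.1 ha
  have := (Finset.mem_Icc.1 hn).2
  exact factorial_cast_ne_zero (by omega)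

lemma exists_factorial_eq_eval_evenPoly_mul {j : ℕ} {y : ZMod p}
    (h : (evenPoly (ZMod p) j).eval y ≠ 0) :
    ∃ m, m + 2 * j < p ∧
      ((m + 2 * j)! : ZMod p) = (evenPoly (ZMod p) j).eval y * (m ! : ZMod p) := by
  set n := (y + j - 2⁻¹).val with hn
  have hnp : n < p := ZMod.val_lt _
  have hny : (n : ZMod p) = y + j - 2⁻¹ := ZMod.natCast_zmod_val _
  have heval : (evenPoly (ZMod p) j).eval y = ∏ s ∈ Finset.range (2 * j), ((n : ZMod p) - s) := by
    rw [evenPoly, eval_prod]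
    refine Finset.prod_congr rfl fun s _ => ?_
    rw [eval_sub, eval_X, eval_C, hny]
    ring
  have hle : 2 * j ≤ n := by
    by_contra! hlt
    exact h (heval.trans (Finset.prod_eq_zero (Finset.mem_range.2 hlt) (sub_self _)))
  refine ⟨n - 2 * j, by omega, ?_⟩
  rw [Nat.sub_add_cancel hle, ← Nat.factorial_mul_descFactorial hle, Nat.cast_mul, mul_comm,
    Nat.descFactorial_eq_prod_range, Nat.cast_prod, heval]
  congr 1
  refine Finset.prod_congr rfl fun s hs => ?_
  rw [Nat.cast_sub (by have := Finset.mem_range.1 hs; omega)]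

/-- The representations of `x` as a quotient of two elements of `factorialResidues p`. -/
def quotientReps (p : ℕ) [Fact p.Prime] (x : ZMod p) : Finset (ZMod p × ZMod p) :=
  (factorialResidues p ×ˢ factorialResidues p).filter fun z => z.1 / z.2 = x

lemma factorial_mem_quotientReps {m n : ℕ} {x : ZMod p} (hm : m < p) (hn : n < p)
    (h : (n ! : ZMod p) = x * (m ! : ZMod p)) :
    ((n ! : ZMod p), (m ! : ZMod p)) ∈ quotientReps p x :=
  Finset.mem_filter.2 ⟨Finset.mem_product.2
    ⟨factorial_mem_factorialResidues hn, factorial_mem_factorialResidues hm⟩,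
    (div_eq_iff (factorial_cast_ne_zero hm)).2 h⟩

lemma one_le_card_quotientReps {x : ZMod p} (hx : x ≠ 0) : 1 ≤ (quotientReps p x).card := by
  have hval : 0 < x.val := Nat.pos_of_ne_zero ((ZMod.val_ne_zero x).2 hx)
  have hlt := ZMod.val_lt x
  refine Finset.card_pos.2 ⟨_, factorial_mem_quotientReps (m := x.val - 1) (n := x.val)
    (by omega) hlt ?_⟩
  rw [← Nat.mul_factorial_pred hval.ne', Nat.cast_mul, ZMod.natCast_zmod_val]

lemma two_le_card_quotientReps {j : ℕ} {x y : ZMod p} (hx : x ≠ 0)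
    (hy : (evenPoly (ZMod p) j).eval y = x) (h1 : ∀ a ∈ factorialResidues p, a ^ 2 ≠ x)
    (h2 : ∀ a ∈ factorialResidues p, -a ^ 2 ≠ x) : 2 ≤ (quotientReps p x).card := by
  obtain ⟨m, hmp, hm⟩ := exists_factorial_eq_eval_evenPoly_mul (p := p) (j := j) (y := y)
    (by rwa [hy])
  rw [hy] at hm
  have hm0 : (m ! : ZMod p) ≠ 0 := factorial_cast_ne_zero (by omega)
  have hA := factorial_mul_factorial_compl (p := p) (n := m) (by omega)
  have hB := factorial_mul_factorial_compl hmp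
  rw [show m + 2 * j + 1 = m + 1 + 2 * j by ring, pow_add, pow_mul, neg_one_sq, one_pow,
    mul_one, hm] at hB
  have hrep := factorial_mem_quotientReps (by omega) hmp hm
  have hrep' : ((((p - 1 - m)! : ℕ) : ZMod p), (((p - 1 - (m + 2 * j))! : ℕ) : ZMod p)) ∈
      quotientReps p x :=
    factorial_mem_quotientReps (by omega) (by omega) (mul_left_cancel₀ hm0 (by
      linear_combination hA - hB))
  refine Finset.one_lt_card.2 ⟨_, hrep, _, hrep', fun heq => ?_⟩
  have hmem := factorial_mem_factorialResidues hmp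
  have heq1 := (Prod.mk.inj heq).1
  rw [← heq1] at hA
  rcases neg_one_pow_eq_or (ZMod p) (m + 1) with hs | hs
  · rw [hs] at hA
    refine h1 _ hmem ?_
    linear_combination ((m + 2 * j)! : ZMod p) * hm + x * hA
  · rw [hs] at hA
    refine h2 _ hmem ?_
    linear_combination -((m + 2 * j)! : ZMod p) * hm - x * hA

lemma sum_card_quotientReps :
    ∑ x ∈ Finset.univ.erase 0, (quotientReps p x).card = (factorialResidues p).card ^ 2 := by
  rw [sq, ← Finset.card_product]
  refine (Finset.card_eq_sum_card_fiberwise fun z hz => ?_).symm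
  obtain ⟨h1, h2⟩ := Finset.mem_product.1 hz
  exact Finset.mem_coe.2 (Finset.mem_erase.2 ⟨div_ne_zero (ne_zero_of_mem_factorialResidues h1)
    (ne_zero_of_mem_factorialResidues h2), Finset.mem_univ _⟩)

lemma two_mul_le_card_factorialResidues {W : Finset (ZMod p)}
    (hW : ∀ x ∉ W, ∃ j y, (evenPoly (ZMod p) j).eval y = x) :
    2 * (p - 1) ≤ (factorialResidues p).card ^ 2 + W.card + 2 * (factorialResidues p).card := by
  set A := factorialResidues p with hA
  set E := A.image (fun a => a ^ 2) ∪ A.image (fun a => -a ^ 2) with hE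
  have hEcard : E.card ≤ 2 * A.card := by
    rw [two_mul]
    exact (Finset.card_union_le _ _).trans (add_le_add Finset.card_image_le Finset.card_image_le)
  have hU : (Finset.univ.erase (0 : ZMod p)).card = p - 1 := by
    rw [Finset.card_erase_of_mem (Finset.mem_univ _), Finset.card_univ, ZMod.card]
  have hterm : ∀ x ∈ Finset.univ.erase (0 : ZMod p),
      2 ≤ (quotientReps p x).card + if x ∈ W ∪ E then 1 else 0 := by
    intro x hx
    have hx0 := (Finset.mem_erase.1 hx).1
    split_ifs with h
    · exact Nat.succ_le_succ (one_le_card_quotientReps hx0)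
    · rw [Finset.mem_union, not_or, hE, Finset.mem_union, not_or] at h
      obtain ⟨j, y, hy⟩ := hW x h.1
      exact two_le_card_quotientReps hx0 hy
        (fun a ha h' => h.2.1 (Finset.mem_image.2 ⟨a, ha, h'⟩))
        (fun a ha h' => h.2.2 (Finset.mem_image.2 ⟨a, ha, h'⟩))
  have hsum := Finset.sum_le_sum hterm
  rw [Finset.sum_const, hU, smul_eq_mul, Finset.sum_add_distrib, sum_card_quotientReps,
    Finset.sum_ite_mem, Finset.sum_const, smul_eq_mul, mul_one] at hsum
  have h1 : (Finset.univ.erase 0 ∩ (W ∪ E)).card ≤ W.card + E.card :=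
    (Finset.card_le_card Finset.inter_subset_right).trans (Finset.card_union_le _ _)
  rw [← hA] at hsum
  omega

end Counting

lemma exists_sqrt_two_sub_mul_le {ε : ℝ} (hε : 0 < ε) :
    ∃ η : ℝ, 0 < η ∧ ∀ᶠ p : ℕ in Filter.atTop, ∀ a : ℝ, 0 ≤ a →
      2 * ((p : ℝ) - 1) ≤ a ^ 2 + η * p + 2 * a → (Real.sqrt 2 - ε) * Real.sqrt p ≤ a := by
  have h2 : Real.sqrt 2 ^ 2 = 2 := Real.sq_sqrt (by norm_num)
  have h20 : 0 ≤ Real.sqrt 2 := Real.sqrt_nonneg 2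
  refine ⟨ε ^ 2, by positivity, ?_⟩
  have htend : Filter.Tendsto (fun p : ℕ => Real.sqrt p) Filter.atTop Filter.atTop :=
    Real.tendsto_sqrt_atTop.comp tendsto_natCast_atTop_atTop
  by_cases hlt : Real.sqrt 2 ≤ ε
  · refine Filter.Eventually.of_forall fun p a ha _ => le_trans ?_ ha
    exact mul_nonpos_of_nonpos_of_nonneg (by linarith) (Real.sqrt_nonneg _)
  push Not at hlt
  have hc : 0 < 2 * ε * (Real.sqrt 2 - ε) := by
    have := sub_pos.2 hlt
    positivity
  filter_upwards [htend.eventually_ge_atTop ((2 * Real.sqrt 2 + 2) / (2 * ε * (Real.sqrt 2 - ε))),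
    htend.eventually_ge_atTop 1] with p hp hp1 a ha hle
  rw [div_le_iff₀ hc] at hp
  set q := Real.sqrt p with hq
  have hqq : (p : ℝ) = q ^ 2 := (Real.sq_sqrt (Nat.cast_nonneg p)).symm
  rw [hqq] at hle
  by_contra! hcon
  have ha2 : a ^ 2 < ((Real.sqrt 2 - ε) * q) ^ 2 := pow_lt_pow_left₀ hcon ha two_ne_zero
  have ha3 : a ≤ Real.sqrt 2 * q := by nlinarith
  have h3 := mul_le_mul_of_nonneg_right hp (by linarith : 0 ≤ q)
  nlinarith

end FactorialResidues

/-- **Corollary.** `|A(p)| ≥ (√2 + o(1))·√p`: for every `ε > 0` there is `p₀` such that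
every prime `p > p₀` satisfies `|A(p)| ≥ (√2 − ε)·√p`. -/
theorem card_factorialResidues_ge :
    ∀ ε : ℝ, ε > 0 → ∃ p₀ : ℕ, ∀ p : ℕ, p.Prime → p > p₀ →
      ((factorialResidues p).card : ℝ) ≥ (Real.sqrt 2 - ε) * Real.sqrt p := by
  classical
  intro ε hε
  obtain ⟨η, hη, hreal⟩ := FactorialResidues.exists_sqrt_two_sub_mul_le hε
  obtain ⟨J, hJ⟩ := FactorialResidues.exists_evenPoly_values_dense hη
  obtain ⟨p₀, hp₀⟩ := Filter.eventually_atTop.1 (hreal.and hJ)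
  refine ⟨p₀, fun p hp hlt => ?_⟩
  have : Fact p.Prime := ⟨hp⟩
  obtain ⟨hbound, hvalues⟩ := hp₀ p hlt.le
  let W : Finset (ZMod p) := Finset.univ.filter fun x =>
    ∀ j ∈ J, ∀ y, (FactorialResidues.evenPoly (ZMod p) j).eval y ≠ x
  have hW : (W.card : ℝ) ≤ η * p := hvalues W fun x hx => (Finset.mem_filter.1 hx).2
  have hcount := FactorialResidues.two_mul_le_card_factorialResidues (W := W) fun x hx => by
    have hx' : ¬ ∀ j ∈ J, ∀ y, (FactorialResidues.evenPoly (ZMod p) j).eval y ≠ x :=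
      fun h => hx (Finset.mem_filter.2 ⟨Finset.mem_univ x, h⟩)
    push Not at hx'
    obtain ⟨j, -, y, hy⟩ := hx'
    exact ⟨j, y, hy⟩
  have hcast : (2 : ℝ) * ((p : ℝ) - 1) ≤ ((factorialResidues p).card : ℝ) ^ 2 + W.card +
      2 * (factorialResidues p).card := by
    have h1 := Nat.cast_pred (R := ℝ) hp.pos
    rw [← h1]
    exact_mod_cast hcount
  exact hbound _ (Nat.cast_nonneg _) (by linarith)
end

section
/- Let A₁, A₂, …, Aₙ be finite sets (n ≥ 1), and let a ≥ b be positive integers such that |Aᵢ| ≥ a for all i, and |Aᵢ ∩ Aⱼ| ≤ b for all i ≠ j. Then the union A = A₁ ∪ A₂ ∪ … ∪ Aₙ satisfies |A| ≥ (a²/b)·(1 − a/(n·b)). -/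
/-- Cauchy–Schwarz for the multiplicity function of a finite family of finite sets. -/
theorem sq_sum_card_le_card_biUnion_mul_sum_card_inter {ι α : Type*} [Fintype ι] [DecidableEq α]
    (B : ι → Finset α) :
    (∑ i, (B i).card) ^ 2 ≤
      (Finset.univ.biUnion B).card * ∑ i, ∑ j, (B i ∩ B j).card := by
  set U := Finset.univ.biUnion B with hU
  have card_eq (S : Finset α) (hS : S ⊆ U) : S.card = ∑ x ∈ U, if x ∈ S then 1 else 0 := by
    rw [← Finset.sum_filter, Finset.filter_mem_eq_inter, Finset.inter_eq_right.mpr hS,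
      Finset.card_eq_sum_ones]
  have hsub (i : ι) : B i ⊆ U := Finset.subset_biUnion_of_mem B (Finset.mem_univ i)
  have h_sum : ∑ i, (B i).card = ∑ x ∈ U, ∑ i, (if x ∈ B i then 1 else 0 : ℕ) := by
    rw [Finset.sum_comm (s := U)]
    exact Finset.sum_congr rfl fun i _ => card_eq _ (hsub i)
  have h_sq : ∑ i, ∑ j, (B i ∩ B j).card = ∑ x ∈ U, (∑ i, if x ∈ B i then 1 else 0 : ℕ) ^ 2 := by
    simp_rw [sq, Finset.sum_mul_sum]
    rw [Finset.sum_comm (s := U)]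
    refine Finset.sum_congr rfl fun i _ => ?_
    rw [Finset.sum_comm (s := U)]
    refine Finset.sum_congr rfl fun j _ => ?_
    rw [card_eq _ (Finset.inter_subset_left.trans (hsub i))]
    refine Finset.sum_congr rfl fun x _ => ?_
    by_cases hi : x ∈ B i <;> by_cases hj : x ∈ B j <;> simp [hi, hj]
  rw [h_sum, h_sq]
  exact sq_sum_le_card_mul_sum_sq

/-- **Lemma 1.** If `|Aᵢ| ≥ a` for all `i` and `|Aᵢ ∩ Aⱼ| ≤ b` for all `i ≠ j`, with
`a ≥ b` positive integers, then `|A₁ ∪ ⋯ ∪ Aₙ| ≥ (a²/b)·(1 − a/(n·b))`. -/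
theorem card_union_ge_of_card_inter_le {α : Type*} [DecidableEq α]
    (n : ℕ) (hn : 1 ≤ n) (A : Fin n → Finset α) (a b : ℕ)
    (hb : 0 < b) (hab : b ≤ a)
    (hA : ∀ i, a ≤ (A i).card)
    (hAB : ∀ i j, i ≠ j → (A i ∩ A j).card ≤ b) :
    ((Finset.univ.biUnion A).card : ℝ) ≥
      ((a : ℝ) ^ 2 / (b : ℝ)) * (1 - (a : ℝ) / ((n : ℝ) * (b : ℝ))) := by
  choose B hBA hB using fun i => Finset.exists_subset_card_eq (hA i)
  have hU : (Finset.univ.biUnion B).card ≤ (Finset.univ.biUnion A).card :=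
    Finset.card_le_card (Finset.biUnion_mono fun i _ => hBA i)
  have h_inter : ∑ i, ∑ j, (B i ∩ B j).card ≤ n * (n * b + (a - b)) := by
    have h (i j : Fin n) : (B i ∩ B j).card ≤ b + if i = j then a - b else 0 := by
      by_cases hij : i = j
      · subst hij
        simp [hB, hab]
      · simpa [hij] using
          (Finset.card_le_card (Finset.inter_subset_inter (hBA i) (hBA j))).trans (hAB i j hij)
    refine (Finset.sum_le_sum fun i _ => Finset.sum_le_sum fun j _ => h i j).trans_eq ?_
    simp [Finset.sum_add_distrib, mul_add]
  have h_nat : (n * a) ^ 2 ≤ (Finset.univ.biUnion A).card * (n * (n * b + (a - b))) := by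
    refine le_trans ?_ (Nat.mul_le_mul hU h_inter)
    simpa [hB] using sq_sum_card_le_card_biUnion_mul_sum_card_inter B
  have h_real : ((n : ℝ) * a) ^ 2 ≤
      (Finset.univ.biUnion A).card * (n * (n * b + (a - b))) := by
    have := (Nat.cast_le (α := ℝ)).mpr h_nat
    push_cast [Nat.cast_sub hab] at this
    exact this
  have hn' : (0 : ℝ) < n := by exact_mod_cast hn
  have hb' : (0 : ℝ) < b := by exact_mod_cast hb
  have hab' : (b : ℝ) ≤ a := by exact_mod_cast hab
  generalize ((Finset.univ.biUnion A).card : ℝ) = u at h_real ⊢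
  generalize (n : ℝ) = n at *
  generalize (a : ℝ) = a at *
  generalize (b : ℝ) = b at *
  have hD : 0 < n * b + (a - b) := by nlinarith [mul_pos hn' hb']
  have h_lower : n * a ^ 2 / (n * b + (a - b)) ≤ u := by
    rw [div_le_iff₀ hD]
    refine le_of_mul_le_mul_left ?_ hn'
    linarith
  refine ge_iff_le.mpr (le_trans ?_ h_lower)
  have h_eq : a ^ 2 / b * (1 - a / (n * b)) = a ^ 2 * (n * b - a) / (n * b ^ 2) := by
    field_simp
  rw [h_eq, div_le_div_iff₀ (by positivity) hD]
  have h_gap : 0 ≤ a ^ 2 * (n * b ^ 2 + a * (a - b)) := by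
    have := sub_nonneg.mpr hab'
    have : 0 ≤ a := hb'.le.trans hab'
    positivity
  linarith
end
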